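/- Let p ≥ 3 and (β,h) be a p-special point with unique global maximizer m_* of H = H_{β,h,p}. Then there exist constants C > 0 and C' > 0 such that for all N ≥ 1, for both r ∈ {0,1}, and for all x ∈ [0, C·N^{1/20}], | P( (−1)^r (S_N − N m_*)/N^{3/4} > x ) / (1 − F(x)) − 1 | ≤ C'(1 + x^5)·N^{−1/4}, where F is the distribution on ℝ with Lebesgue density dF(x) = (2/Γ(1/4)) (−H^{(4)}(m_*)/24)^{1/4} exp( H^{(4)}(m_*) x^4 / 24 ) dx. -/

import Mathlib

open Real MeasureTheory Filter
open scoped BigOperators Topology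

noncomputable section

/-- The spin value (`±1`) of a Boolean coordinate. -/
def spin (b : Bool) : ℝ := if b then 1 else -1

/-- The total magnetization `S_N = ∑ᵢ Xᵢ` of a configuration. -/
def mag {N : ℕ} (x : Fin N → Bool) : ℝ := ∑ i, spin (x i)

/-- The Hamiltonian of the `p`-spin Curie-Weiss model:
`β N^{1-p} ∑_{i₁,…,i_p} x_{i₁} ⋯ x_{i_p} + h ∑ᵢ xᵢ`. -/
def cwHamiltonian (p N : ℕ) (β h : ℝ) (x : Fin N → Bool) : ℝ :=
  β * (N : ℝ) ^ ((1 : ℤ) - (p : ℤ)) * (∑ i : Fin p → Fin N, ∏ j, spin (x (i j)))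
    + h * mag x

/-- The (unnormalized) Gibbs weight of a configuration. -/
def cwWeight (p N : ℕ) (β h : ℝ) (x : Fin N → Bool) : ℝ :=
  Real.exp (cwHamiltonian p N β h x)

/-- The probability of an event `E` under the `p`-spin Curie-Weiss measure `P_{β,h,p}`. -/
def cwProb (p N : ℕ) (β h : ℝ) (E : Set (Fin N → Bool)) : ℝ :=
  (∑ x : Fin N → Bool, E.indicator (cwWeight p N β h) x) /
    ∑ x : Fin N → Bool, cwWeight p N β h x

/-- Conditional probability of `E` given `A` under the `p`-spin Curie-Weiss measure. -/
def cwCondProb (p N : ℕ) (β h : ℝ) (E A : Set (Fin N → Bool)) : ℝ :=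
  cwProb p N β h (E ∩ A) / cwProb p N β h A

/-- The binary entropy function `I(x) = ½[(1+x)log(1+x) + (1-x)log(1-x)]`. -/
def binEnt (x : ℝ) : ℝ := (1/2) * ((1+x) * Real.log (1+x) + (1-x) * Real.log (1-x))

/-- The function `H_{β,h,p}(x) = βxᵖ + hx - I(x)`. -/
def Hfun (p : ℕ) (β h : ℝ) (x : ℝ) : ℝ := β * x ^ p + h * x - binEnt x

/-- `m` is a global maximizer of `H_{β,h,p}` on `[-1,1]`, lying in `(-1,1)`. -/
def isMaximizer (p : ℕ) (β h m : ℝ) : Prop :=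
  m ∈ Set.Ioo (-1 : ℝ) 1 ∧ ∀ x ∈ Set.Icc (-1 : ℝ) 1, Hfun p β h x ≤ Hfun p β h m

/-- `m` is the unique global maximizer of `H_{β,h,p}`. -/
def isUniqueMaximizer (p : ℕ) (β h m : ℝ) : Prop :=
  isMaximizer p β h m ∧ ∀ m', isMaximizer p β h m' → m' = m

/-- `(β,h)` is a `p`-regular point with unique global maximizer `m`. -/
def pRegular (p : ℕ) (β h m : ℝ) : Prop :=
  isUniqueMaximizer p β h m ∧ iteratedDeriv 2 (Hfun p β h) m < 0

/-- `(β,h)` is a `p`-special point with unique global maximizer `m`. -/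
def pSpecial (p : ℕ) (β h m : ℝ) : Prop :=
  isUniqueMaximizer p β h m ∧ iteratedDeriv 2 (Hfun p β h) m = 0

/-- `(β,h)` is a `p`-critical point: `H_{β,h,p}` has more than one global maximizer. -/
def pCritical (p : ℕ) (β h : ℝ) : Prop :=
  ∃ m₁ m₂, m₁ ≠ m₂ ∧ isMaximizer p β h m₁ ∧ isMaximizer p β h m₂

/-- The probability assigned to a set `S ⊆ ℝ` by the centered Gaussian with variance `v`. -/
def gaussProb (v : ℝ) (S : Set ℝ) : ℝ :=
  ∫ t in S, (Real.sqrt (2 * Real.pi * v))⁻¹ * Real.exp (-t ^ 2 / (2 * v))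

/-- The CDF of the centered Gaussian with variance `v`. -/
def gaussCDF (v x : ℝ) : ℝ := gaussProb v (Set.Iic x)

/-- The standard normal CDF `Φ`. -/
def stdNormCDF (x : ℝ) : ℝ := gaussCDF 1 x

/-- The CDF of the limit law `F` at a `p`-special point, where `c = H⁽⁴⁾(m_*)`:
`dF(x) = (2/Γ(1/4)) (-c/24)^{1/4} exp(c x⁴/24) dx`. -/
def specialCDF (c x : ℝ) : ℝ :=
  ∫ t in Set.Iic x, (2 / Real.Gamma (1/4)) * ((-c) / 24) ^ ((1:ℝ)/4) * Real.exp (c * t ^ 4 / 24)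

/-- The inverse hyperbolic tangent `tanh⁻¹(t) = ½ log((1+t)/(1-t))`. -/
def arctanh (t : ℝ) : ℝ := (1/2) * Real.log ((1+t)/(1-t))

/-- The function `g(t) = tanh⁻¹(t)/(p t^{p-1})`, so that the maximum pseudolikelihood
estimate of `β` is `g(X̄)`. -/
def gMPL (p : ℕ) (t : ℝ) : ℝ := arctanh t / (p * t ^ (p - 1))

/-- The threshold `β*(p) = inf{β ≥ 0 : sup_{x∈[0,1]} H_{β,0,p}(x) > 0}`. -/
def betaStar (p : ℕ) : ℝ := sInf {b : ℝ | 0 ≤ b ∧ ∃ x ∈ Set.Icc (0:ℝ) 1, 0 < Hfun p b 0 x}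

/-- The tail integral `∫_x^∞ exp(-a t⁴) dt`. -/
def quarticTail (a x : ℝ) : ℝ := ∫ t in Set.Ioi x, Real.exp (-a * t ^ 4)

lemma integrable_exp_neg_mul_pow_four {a : ℝ} (ha : 0 < a) :
    Integrable (fun t : ℝ => Real.exp (-a * t ^ 4)) := by
  refine ((integrable_exp_neg_mul_sq ha).const_mul (Real.exp a)).mono'
    (by fun_prop) (Eventually.of_forall fun t => ?_)
  rw [Real.norm_eq_abs, abs_of_pos (Real.exp_pos _), ← Real.exp_add, Real.exp_le_exp]
  nlinarith [mul_nonneg ha.le (sq_nonneg (t ^ 2 - 1)), mul_nonneg ha.le (sq_nonneg t)]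

lemma exp_neg_mul_pow_four_antitone {a : ℝ} (ha : 0 < a) {s t : ℝ} (hs : 0 ≤ s) (hst : s ≤ t) :
    Real.exp (-a * t ^ 4) ≤ Real.exp (-a * s ^ 4) := by
  rw [Real.exp_le_exp]
  have : s ^ 4 ≤ t ^ 4 := by gcongr
  nlinarith

lemma quarticTail_antitone {a x y : ℝ} (ha : 0 < a) (hxy : x ≤ y) :
    quarticTail a y ≤ quarticTail a x := by
  apply setIntegral_mono_set (integrable_exp_neg_mul_pow_four ha).integrableOn
  · exact Eventually.of_forall fun t => (Real.exp_pos _).le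
  · exact (Set.Ioi_subset_Ioi hxy).eventuallyLE

lemma quarticTail_le {a z : ℝ} (ha : 0 < a) (hz : 0 ≤ z) :
    quarticTail a z ≤ Real.exp (-(a / 2) * z ^ 4) * ∫ t, Real.exp (-(a / 2) * t ^ 4) := by
  have hint := integrable_exp_neg_mul_pow_four (half_pos ha)
  calc quarticTail a z ≤ ∫ t in Set.Ioi z, Real.exp (-(a / 2) * z ^ 4) * Real.exp (-(a / 2) * t ^ 4) := by
        apply setIntegral_mono_on (integrable_exp_neg_mul_pow_four ha).integrableOn
          (hint.const_mul _).integrableOn measurableSet_Ioi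
        intro t ht
        rw [← Real.exp_add, Real.exp_le_exp]
        have ht' : z < t := ht
        have : z ^ 4 ≤ t ^ 4 := by gcongr
        nlinarith
    _ = Real.exp (-(a / 2) * z ^ 4) * ∫ t in Set.Ioi z, Real.exp (-(a / 2) * t ^ 4) := by
        rw [integral_const_mul]
    _ ≤ _ := by
        exact mul_le_mul_of_nonneg_left (setIntegral_le_integral hint
          (Eventually.of_forall fun t => (Real.exp_pos _).le)) (Real.exp_pos _).le

lemma quarticTail_eq_add {a x y : ℝ} (ha : 0 < a) (hxy : x ≤ y) :
    quarticTail a x = (∫ t in x..y, Real.exp (-a * t ^ 4)) + quarticTail a y := by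
  have hint := integrable_exp_neg_mul_pow_four ha
  rw [intervalIntegral.integral_of_le hxy, quarticTail, quarticTail,
    ← setIntegral_union (Set.Ioc_disjoint_Ioi le_rfl) measurableSet_Ioi hint.integrableOn
      hint.integrableOn, Set.Ioc_union_Ioi_eq_Ioi hxy]

lemma integral_exp_quartic_le {a x y : ℝ} (ha : 0 < a) (hx : 0 ≤ x) (hxy : x ≤ y) :
    ∫ t in x..y, Real.exp (-a * t ^ 4) ≤ (y - x) * Real.exp (-a * x ^ 4) := by
  have hint := integrable_exp_neg_mul_pow_four ha
  calc _ ≤ ∫ t in x..y, Real.exp (-a * x ^ 4) := by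
        apply intervalIntegral.integral_mono_on hxy hint.intervalIntegrable (by simp)
        intro t ht
        exact exp_neg_mul_pow_four_antitone ha hx ht.1
    _ = _ := by simp

lemma le_integral_exp_quartic {a x y : ℝ} (ha : 0 < a) (hx : 0 ≤ x) (hxy : x ≤ y) :
    (y - x) * Real.exp (-a * y ^ 4) ≤ ∫ t in x..y, Real.exp (-a * t ^ 4) := by
  have hint := integrable_exp_neg_mul_pow_four ha
  calc _ = ∫ t in x..y, Real.exp (-a * y ^ 4) := by simp
    _ ≤ _ := by
        apply intervalIntegral.integral_mono_on hxy (by simp) hint.intervalIntegrable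
        intro t ht
        exact exp_neg_mul_pow_four_antitone ha (hx.trans ht.1) ht.2

lemma quarticTail_lower {a x : ℝ} (ha : 0 < a) (hx : 0 ≤ x) :
    Real.exp (-15 * a) * (Real.exp (-a * x ^ 4) / (1 + x) ^ 3) ≤ quarticTail a x := by
  set d : ℝ := 1 / (1 + x) ^ 3 with hd
  have h1 : (1 : ℝ) ≤ (1 + x) ^ 3 := one_le_pow₀ (by linarith)
  have hd0 : 0 < d := by positivity
  have hd1 : d ≤ 1 := by rw [hd, div_le_one (by positivity)]; exact h1
  have hdx : d * (1 + x) ^ 3 = 1 := by rw [hd]; field_simp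
  have hxd : x ≤ x + d := by linarith
  have h0 : 0 ≤ quarticTail a (x + d) := integral_nonneg fun t => (Real.exp_pos _).le
  have h2 := le_integral_exp_quartic ha hx hxd
  rw [quarticTail_eq_add ha hxd]
  have key : (x + d) ^ 4 ≤ x ^ 4 + 15 := by
    have e1 : d * x ^ 3 ≤ 1 := by
      rw [← hdx]; gcongr; linarith
    have e2 : d * x ^ 2 ≤ 1 := by
      rw [← hdx]; gcongr
      calc x ^ 2 ≤ (1 + x) ^ 2 := by gcongr; linarith
        _ ≤ (1 + x) ^ 3 := pow_le_pow_right₀ (by linarith) (by norm_num)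
    have e3 : d * x ≤ 1 := by
      rw [← hdx]; gcongr
      calc x ≤ (1 + x) ^ 1 := by linarith
        _ ≤ (1 + x) ^ 3 := pow_le_pow_right₀ (by linarith) (by norm_num)
    have e2' : d * x ^ 2 * d ≤ 1 := by
      have : 0 ≤ d * x ^ 2 := by positivity
      nlinarith
    have e3' : d * x * d ^ 2 ≤ 1 := by
      have : 0 ≤ d * x := by positivity
      have : d ^ 2 ≤ 1 := pow_le_one₀ hd0.le hd1
      nlinarith
    have e4 : d ^ 4 ≤ 1 := pow_le_one₀ hd0.le hd1
    nlinarith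
  have h3 : Real.exp (-15 * a) * Real.exp (-a * x ^ 4) ≤ Real.exp (-a * (x + d) ^ 4) := by
    rw [← Real.exp_add, Real.exp_le_exp]
    nlinarith
  calc Real.exp (-15 * a) * (Real.exp (-a * x ^ 4) / (1 + x) ^ 3)
      = d * (Real.exp (-15 * a) * Real.exp (-a * x ^ 4)) := by rw [hd]; ring
    _ ≤ d * Real.exp (-a * (x + d) ^ 4) := by gcongr
    _ ≤ _ := by rw [add_sub_cancel_left] at h2; linarith

lemma quarticTail_pos {a x : ℝ} (ha : 0 < a) (hx : 0 ≤ x) : 0 < quarticTail a x :=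
  lt_of_lt_of_le (by positivity) (quarticTail_lower ha hx)

/-- Riemann sums of `exp(-a t⁴)` on an arithmetic grid compared with the integral. -/
lemma riemannSum_exp_quartic {a η s : ℝ} (ha : 0 < a) (hη : 0 ≤ η) (hs : 0 ≤ s) (n : ℕ) :
    (∫ t in s..(s + η * n), Real.exp (-a * t ^ 4)) ≤
        η * ∑ j ∈ Finset.range n, Real.exp (-a * (s + η * j) ^ 4) ∧
      η * ∑ j ∈ Finset.range n, Real.exp (-a * (s + η * j) ^ 4) ≤
        (∫ t in s..(s + η * n), Real.exp (-a * t ^ 4)) +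
          η * (Real.exp (-a * s ^ 4) - Real.exp (-a * (s + η * n) ^ 4)) := by
  have hint := integrable_exp_neg_mul_pow_four ha
  induction n with
  | zero => simp
  | succ n ih =>
    have hτ : 0 ≤ s + η * n := by positivity
    have hle : s + η * n ≤ s + η * (n + 1 : ℕ) := by push_cast; nlinarith
    have h1 := integral_exp_quartic_le ha hτ hle
    have h2 := le_integral_exp_quartic ha hτ hle
    have h3 : (s + η * (n + 1 : ℕ)) - (s + η * n) = η := by push_cast; ring
    rw [h3] at h1 h2
    rw [Finset.sum_range_succ, mul_add, ← intervalIntegral.integral_add_adjacent_intervals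
      (hint.intervalIntegrable (a := s) (b := s + η * n)) hint.intervalIntegrable]
    constructor <;> nlinarith [ih.1, ih.2]

lemma riemannSum_sub_quarticTail {a η s x : ℝ} (ha : 0 < a) (hη : 0 ≤ η) (hx : 0 ≤ x)
    (hxs : x ≤ s) (hsx : s ≤ x + η) (n : ℕ) :
    |η * ∑ j ∈ Finset.range n, Real.exp (-a * (s + η * j) ^ 4) - quarticTail a x| ≤
      η * Real.exp (-a * x ^ 4) + quarticTail a (s + η * n) := by
  have hs : 0 ≤ s := hx.trans hxs
  obtain ⟨h1, h2⟩ := riemannSum_exp_quartic ha hη hs n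
  have hsn : s ≤ s + η * n := by nlinarith [mul_nonneg hη (Nat.cast_nonneg (α := ℝ) n)]
  have h3 := quarticTail_eq_add ha hxs
  have h4 := quarticTail_eq_add ha hsn
  have h5 := integral_exp_quartic_le ha hx hxs
  have h6 : (s - x) * Real.exp (-a * x ^ 4) ≤ η * Real.exp (-a * x ^ 4) := by
    gcongr; linarith
  have h7 : η * Real.exp (-a * s ^ 4) ≤ η * Real.exp (-a * x ^ 4) := by
    gcongr η * ?_
    exact exp_neg_mul_pow_four_antitone ha hx hxs
  have h8 : 0 ≤ η * Real.exp (-a * (s + η * n) ^ 4) := by positivity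
  have h9 : 0 ≤ ∫ t in x..s, Real.exp (-a * t ^ 4) :=
    intervalIntegral.integral_nonneg hxs fun t _ => (Real.exp_pos _).le
  have h10 : 0 < quarticTail a (s + η * n) := quarticTail_pos ha (by linarith)
  rw [abs_le]
  constructor <;> nlinarith

lemma pow_four_sub_lower {x t : ℝ} (hx : 0 ≤ x) (hxt : x ≤ t) :
    (1 / 4) * ((1 + x) ^ 3 * (t - x)) - 1 ≤ t ^ 4 - x ^ 4 := by
  obtain ⟨v, rfl⟩ : ∃ v, t = x + v := ⟨t - x, by ring⟩
  have hv : 0 ≤ v := by linarith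
  have h1 : (1 + x) ^ 3 ≤ 4 * (1 + x ^ 3) := by
    nlinarith [mul_nonneg (by linarith : (0 : ℝ) ≤ 1 + x) (sq_nonneg (1 - x))]
  have h2 : v - 1 ≤ v ^ 4 := by nlinarith [sq_nonneg (v ^ 2 - 1 / 2), sq_nonneg (v - 1 / 2)]
  have h3 : (1 + x) ^ 3 * v ≤ 4 * (1 + x ^ 3) * v := by gcongr
  have h4 : 0 ≤ x ^ 2 * v ^ 2 := by positivity
  have h5 : 0 ≤ x * v ^ 3 := by positivity
  have h6 : 0 ≤ x ^ 3 * v := by positivity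
  rw [add_sub_cancel_left]
  nlinarith

lemma pow_five_le {x t : ℝ} (hx : 0 ≤ x) (hxt : x ≤ t) :
    t ^ 5 ≤ x ^ 5 + 2 * t * (t ^ 4 - x ^ 4) := by
  obtain ⟨v, rfl⟩ : ∃ v, t = x + v := ⟨t - x, by ring⟩
  have hv : 0 ≤ v := by linarith
  have : 0 ≤ 2 * (x + v) * ((x + v) ^ 4 - x ^ 4) - ((x + v) ^ 5 - x ^ 5) := by
    ring_nf
    positivity
  linarith

lemma one_add_pow_five_le {x v : ℝ} (hx : 0 ≤ x) (hv : 0 ≤ v) :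
    1 + (x + v) ^ 5 ≤ 16 * (1 + x ^ 5) * (1 + v ^ 5) := by
  have h := add_pow_le hx hv 5
  have : 0 ≤ x ^ 5 * v ^ 5 := by positivity
  have : 0 ≤ x ^ 5 := by positivity
  have : 0 ≤ v ^ 5 := by positivity
  norm_num at h
  nlinarith

lemma one_add_pow_five_le_exp {b v : ℝ} (hb : 0 < b) (hv : 0 ≤ v) :
    1 + v ^ 5 ≤ (1 + 120 / b ^ 5) * Real.exp (b * v) := by
  have h1 : (b * v) ^ 5 / (Nat.factorial 5 : ℝ) ≤ Real.exp (b * v) :=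
    Real.pow_div_factorial_le_exp (b * v) (by positivity) 5
  have h2 : 1 ≤ Real.exp (b * v) := Real.one_le_exp (by positivity)
  have h3 : v ^ 5 = 120 / b ^ 5 * ((b * v) ^ 5 / (Nat.factorial 5 : ℝ)) := by
    simp [Nat.factorial]; field_simp
  rw [h3, add_mul, one_mul]
  gcongr

lemma abs_exp_sub_one_le (E : ℝ) : |Real.exp E - 1| ≤ |E| * Real.exp |E| := by
  have h1 := Real.add_one_le_exp E
  have h2 := Real.add_one_le_exp (-E)
  have h3 : Real.exp E * Real.exp (-E) = 1 := by rw [← Real.exp_add]; simp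
  have h4 := Real.exp_pos E
  rcases le_total 0 E with h | h
  · rw [abs_of_nonneg h, abs_of_nonneg (by linarith)]
    nlinarith
  · rw [abs_of_nonpos h, abs_of_nonpos (by linarith [Real.exp_le_one_iff.2 h])]
    nlinarith

/-- A density `exp(-a t⁴ + E)` with small error `E` is close to `exp(-a t⁴)`. -/
lemma abs_exp_quartic_perturb_le {a K δ : ℝ} (ha : 0 < a) (hK : 0 < K)
    (hKδ : 2 * K * δ ≤ a / 2) : ∃ D : ℝ, 0 < D ∧
    ∀ u : ℝ, 1 ≤ u → ∀ x t E : ℝ, 0 ≤ x → x ≤ u → x ≤ t → t ≤ δ * u ^ 5 →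
      |E| ≤ K * (1 + t ^ 5) / u ^ 5 →
      |Real.exp (-a * t ^ 4 + E) - Real.exp (-a * t ^ 4)| ≤
        D * ((1 + x ^ 5) / u ^ 5) * Real.exp (-a * x ^ 4) *
          Real.exp (-(a / 16 * (1 + x) ^ 3) * (t - x)) := by
  refine ⟨K * (16 * (1 + 120 / (a / 16) ^ 5)) * Real.exp (2 * K + a / 2), by positivity, ?_⟩
  intro u hu x t E hx hxu hxt htδ hE
  have hu5 : 0 < u ^ 5 := by positivity
  have ht : 0 ≤ t := hx.trans hxt
  have h44 : 0 ≤ t ^ 4 - x ^ 4 := by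
    have : x ^ 4 ≤ t ^ 4 := by gcongr
    linarith
  have hEb : |E| ≤ 2 * K + a / 2 * (t ^ 4 - x ^ 4) := by
    refine hE.trans ?_
    rw [div_le_iff₀ hu5]
    have h1 := pow_five_le hx hxt
    have h2 : x ^ 5 ≤ u ^ 5 := by gcongr
    have h3 : 1 ≤ u ^ 5 := one_le_pow₀ hu
    calc K * (1 + t ^ 5) ≤ K * (u ^ 5 + (u ^ 5 + 2 * (δ * u ^ 5) * (t ^ 4 - x ^ 4))) := by
          gcongr
          refine h1.trans ?_
          gcongr
      _ = (2 * K + 2 * K * δ * (t ^ 4 - x ^ 4)) * u ^ 5 := by ring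
      _ ≤ _ := by gcongr
  have hx3 : 1 ≤ (1 + x) ^ 3 := one_le_pow₀ (by linarith)
  have h5 : 1 + t ^ 5 ≤ 16 * (1 + x ^ 5) *
      ((1 + 120 / (a / 16) ^ 5) * Real.exp (a / 16 * (1 + x) ^ 3 * (t - x))) := by
    have e1 := one_add_pow_five_le hx (sub_nonneg.2 hxt)
    rw [add_sub_cancel] at e1
    refine e1.trans ?_
    gcongr
    refine (one_add_pow_five_le_exp (b := a / 16) (by positivity) (sub_nonneg.2 hxt)).trans ?_
    have : 0 ≤ t - x := by linarith
    gcongr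
    nlinarith
  have h6 : Real.exp (-a * t ^ 4) * Real.exp |E| ≤ Real.exp (2 * K + a / 2) *
      Real.exp (-a * x ^ 4) * Real.exp (-(a / 8 * (1 + x) ^ 3) * (t - x)) := by
    rw [← Real.exp_add, ← Real.exp_add, ← Real.exp_add, Real.exp_le_exp]
    have := pow_four_sub_lower hx hxt
    nlinarith
  have h7 : Real.exp (-a * t ^ 4 + E) - Real.exp (-a * t ^ 4) =
      Real.exp (-a * t ^ 4) * (Real.exp E - 1) := by rw [Real.exp_add]; ring
  rw [h7, abs_mul, abs_of_pos (Real.exp_pos _)]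
  calc Real.exp (-a * t ^ 4) * |Real.exp E - 1|
      ≤ Real.exp (-a * t ^ 4) * (|E| * Real.exp |E|) := by
        gcongr; exact abs_exp_sub_one_le E
    _ = |E| * (Real.exp (-a * t ^ 4) * Real.exp |E|) := by ring
    _ ≤ (K * (16 * (1 + x ^ 5) * ((1 + 120 / (a / 16) ^ 5) *
          Real.exp (a / 16 * (1 + x) ^ 3 * (t - x)))) / u ^ 5) *
        (Real.exp (2 * K + a / 2) * Real.exp (-a * x ^ 4) *
          Real.exp (-(a / 8 * (1 + x) ^ 3) * (t - x))) := by
        gcongr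
        refine hE.trans ?_
        gcongr
    _ = _ := by
        have : Real.exp (-(a / 16 * (1 + x) ^ 3) * (t - x)) =
            Real.exp (a / 16 * (1 + x) ^ 3 * (t - x)) *
              Real.exp (-(a / 8 * (1 + x) ^ 3) * (t - x)) := by
          rw [← Real.exp_add]; ring_nf
        rw [this]; ring

lemma sum_exp_grid_le {l η : ℝ} (hl : 0 < l) (hη : 0 < η) (n : ℕ) :
    η * ∑ j ∈ Finset.range n, Real.exp (-l * (η * j)) ≤ η + 1 / l := by
  have hr : ∀ j : ℕ, Real.exp (-l * (η * j)) = Real.exp (-(l * η)) ^ j := by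
    intro j; rw [← Real.exp_nat_mul]; ring_nf
  simp_rw [hr]
  set q := Real.exp (-(l * η)) with hq
  have hz : 0 < l * η := by positivity
  have hq1 : q ≤ 1 / (1 + l * η) := by
    rw [hq, Real.exp_neg, ← one_div]
    apply one_div_le_one_div_of_le (by positivity)
    linarith [Real.add_one_le_exp (l * η)]
  have hq0 : 0 < q := Real.exp_pos _
  have hq1' : q * (1 + l * η) ≤ 1 := by rwa [le_div_iff₀ (by positivity)] at hq1
  have hs : (1 - q) * ∑ j ∈ Finset.range n, q ^ j = 1 - q ^ n := by
    have := geom_sum_mul q n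
    linarith
  set G := ∑ j ∈ Finset.range n, q ^ j
  have hS : 0 ≤ G := Finset.sum_nonneg fun _ _ => by positivity
  have hqn : 0 < q ^ n := by positivity
  have h1 : l * η * G ≤ 1 + l * η := by nlinarith
  have : η + 1 / l = (1 + l * η) / l := by field_simp; ring
  rw [this, le_div_iff₀ hl]
  linarith

lemma eventually_exp_pow_twenty_small (a c B : ℝ) (hc : 0 < c) :
    ∀ᶠ u : ℝ in atTop, B * u ^ 48 * Real.exp (-c * u ^ 20) ≤ Real.exp (-a * u ^ 4) := by
  have h1 : Tendsto (fun u : ℝ => B * (u ^ 48 * Real.exp (-u))) atTop (𝓝 (B * 0)) :=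
    (Real.tendsto_pow_mul_exp_neg_atTop_nhds_zero 48).const_mul B
  rw [mul_zero] at h1
  filter_upwards [h1.eventually_le_const zero_lt_one, eventually_ge_atTop 1,
    eventually_ge_atTop ((|a| + 1) / c)] with u h2 h3 h4
  have h5 : -c * u ^ 20 ≤ -u + -a * u ^ 4 := by
    have e1 : |a| + 1 ≤ c * u := by rw [div_le_iff₀ hc] at h4; linarith
    have e2 : u ^ 5 ≤ u ^ 20 := pow_le_pow_right₀ h3 (by norm_num)
    have e3 : u ≤ u ^ 4 := le_self_pow₀ h3 (by norm_num)
    have e4 : (|a| + 1) * u ^ 4 ≤ c * u * u ^ 4 := by gcongr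
    have e5 : a * u ^ 4 ≤ |a| * u ^ 4 := by gcongr; exact le_abs_self a
    have e6 : c * u ^ 5 ≤ c * u ^ 20 := by gcongr
    nlinarith
  rcases le_or_gt B 0 with hB | hB
  · have : B * u ^ 48 * Real.exp (-c * u ^ 20) ≤ 0 :=
      mul_nonpos_of_nonpos_of_nonneg (mul_nonpos_of_nonpos_of_nonneg hB (by positivity))
        (Real.exp_pos _).le
    exact this.trans (Real.exp_pos _).le
  calc B * u ^ 48 * Real.exp (-c * u ^ 20) ≤ B * u ^ 48 * Real.exp (-u + -a * u ^ 4) := by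
        gcongr
    _ = B * (u ^ 48 * Real.exp (-u)) * Real.exp (-a * u ^ 4) := by rw [Real.exp_add]; ring
    _ ≤ 1 * Real.exp (-a * u ^ 4) := by gcongr
    _ = _ := one_mul _

set_option maxHeartbeats 1000000 in
/-- Weighted sums over a fine grid on `[x, ∞)` approximate the quartic tail integral, when the
weights are close to `exp(-a t⁴)` on the bulk and negligible beyond it. -/
lemma grid_tail_estimate {a K δ c B : ℝ} (ha : 0 < a) (hK : 0 < K) (hδ : 0 < δ)
    (hKδ : 2 * K * δ ≤ a / 2) (hc : 0 < c) (hB : 0 < B) :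
    ∃ C : ℝ, 0 < C ∧ ∃ u₀ : ℝ, 1 ≤ u₀ ∧ ∀ u : ℝ, u₀ ≤ u → ∀ (n : ℕ) (s x : ℝ) (v : ℕ → ℝ),
      0 ≤ x → x ≤ u → x ≤ s → s ≤ x + 2 / u ^ 15 → (n : ℝ) ≤ 2 * u ^ 20 →
      δ * u ^ 5 ≤ s + 2 / u ^ 15 * n →
      (∀ j < n, s + 2 / u ^ 15 * j ≤ δ * u ^ 5 →
        ∃ E, |E| ≤ K * (1 + (s + 2 / u ^ 15 * j) ^ 5) / u ^ 5 ∧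
          v j = Real.exp (-a * (s + 2 / u ^ 15 * j) ^ 4 + E)) →
      (∀ j < n, δ * u ^ 5 < s + 2 / u ^ 15 * j →
        0 ≤ v j ∧ v j ≤ B * u ^ 10 * Real.exp (-c * u ^ 20)) →
      |2 / u ^ 15 * ∑ j ∈ Finset.range n, v j - quarticTail a x| ≤
        C * ((1 + x ^ 5) / u ^ 5) * quarticTail a x := by
  obtain ⟨D, hD, hnear⟩ := abs_exp_quartic_perturb_le ha hK hKδ
  set J : ℝ := ∫ t, Real.exp (-(a / 2) * t ^ 4) with hJ
  have hJ0 : 0 ≤ J := integral_nonneg fun t => (Real.exp_pos _).le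
  set c₁ : ℝ := min c (a / 2 * δ ^ 4) with hc₁
  have hc₁0 : 0 < c₁ := lt_min hc (by positivity)
  obtain ⟨u₁, hu₁⟩ := eventually_atTop.1
    (eventually_exp_pow_twenty_small a c₁ (8 * (4 * (B + 1) + J)) hc₁0)
  refine ⟨(D * (16 + 16 / a) + 17) * Real.exp (15 * a), by positivity, max u₁ 1,
    le_max_right _ _, ?_⟩
  intro u hu n s x v hx hxu hxs hsx hn hend hv1 hv2
  have hu1 : 1 ≤ u := (le_max_right _ _).trans hu
  have hsmall := hu₁ u ((le_max_left _ _).trans hu)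
  have hu0 : 0 < u := by linarith
  set η : ℝ := 2 / u ^ 15 with hη
  have hη0 : 0 < η := by positivity
  set G : ℝ := Real.exp (-a * x ^ 4) / (1 + x) ^ 3 with hG
  have hG0 : 0 < G := by positivity
  have hx5 : 0 ≤ x ^ 5 := by positivity
  have hx3 : (1 + x) ^ 3 ≤ 8 * u ^ 3 := by
    calc (1 + x) ^ 3 ≤ (2 * u) ^ 3 := by gcongr; linarith
      _ = 8 * u ^ 3 := by ring
  have hφ : Real.exp (-a * x ^ 4) = (1 + x) ^ 3 * G := by rw [hG]; field_simp
  set F : ℝ := (B + 1) * u ^ 10 * Real.exp (-c₁ * u ^ 20) with hF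
  have hF0 : 0 < F := by positivity
  set l : ℝ := a / 16 * (1 + x) ^ 3 with hl
  have hl0 : 0 < l := by positivity
  have hterm : ∀ j ∈ Finset.range n, |v j - Real.exp (-a * (s + η * j) ^ 4)| ≤
      D * ((1 + x ^ 5) / u ^ 5) * Real.exp (-a * x ^ 4) * Real.exp (-l * (η * j)) + F := by
    intro j hj
    have hjn := Finset.mem_range.1 hj
    have hjη : 0 ≤ η * j := by positivity
    rcases le_or_gt (s + η * j) (δ * u ^ 5) with h | h
    · obtain ⟨E, hE, hvE⟩ := hv1 j hjn h
      have := hnear u hu1 x (s + η * j) E hx hxu (by linarith) h hE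
      rw [← hvE] at this
      refine this.trans ?_
      have : Real.exp (-(a / 16 * (1 + x) ^ 3) * (s + η * j - x)) ≤ Real.exp (-l * (η * j)) := by
        rw [Real.exp_le_exp]
        nlinarith
      calc _ ≤ D * ((1 + x ^ 5) / u ^ 5) * Real.exp (-a * x ^ 4) * Real.exp (-l * (η * j)) := by
            gcongr
        _ ≤ _ := by linarith
    · obtain ⟨h1, h2⟩ := hv2 j hjn h
      have e1 : Real.exp (-c * u ^ 20) ≤ Real.exp (-c₁ * u ^ 20) := by
        rw [Real.exp_le_exp]
        have : c₁ * u ^ 20 ≤ c * u ^ 20 := by gcongr; exact min_le_left _ _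
        linarith
      have e2 : Real.exp (-a * (s + η * j) ^ 4) ≤ u ^ 10 * Real.exp (-c₁ * u ^ 20) := by
        have : Real.exp (-a * (s + η * j) ^ 4) ≤ Real.exp (-c₁ * u ^ 20) := by
          rw [Real.exp_le_exp]
          have e3 : c₁ * u ^ 20 ≤ a / 2 * δ ^ 4 * u ^ 20 := by gcongr; exact min_le_right _ _
          have e4 : (δ * u ^ 5) ^ 4 ≤ (s + η * j) ^ 4 := by gcongr
          have e5 : 0 ≤ δ ^ 4 * u ^ 20 := by positivity
          have e6 : (δ * u ^ 5) ^ 4 = δ ^ 4 * u ^ 20 := by ring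
          nlinarith
        refine this.trans (le_mul_of_one_le_left (Real.exp_pos _).le (one_le_pow₀ hu1))
      have e7 : v j ≤ B * u ^ 10 * Real.exp (-c₁ * u ^ 20) := h2.trans (by gcongr)
      have e8 := Real.exp_pos (-a * (s + η * j) ^ 4)
      have e9 : 0 ≤ D * ((1 + x ^ 5) / u ^ 5) * Real.exp (-a * x ^ 4) *
        Real.exp (-l * (η * j)) := by positivity
      have e10 : |v j - Real.exp (-a * (s + η * j) ^ 4)| ≤ F := by
        have e11 : F = B * u ^ 10 * Real.exp (-c₁ * u ^ 20) + u ^ 10 * Real.exp (-c₁ * u ^ 20) := by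
          rw [hF]; ring
        have e12 : 0 < B * u ^ 10 * Real.exp (-c₁ * u ^ 20) := by positivity
        rw [abs_le, e11]
        constructor <;> linarith
      linarith
  have hsum : |η * ∑ j ∈ Finset.range n, v j -
      η * ∑ j ∈ Finset.range n, Real.exp (-a * (s + η * j) ^ 4)| ≤
      D * ((1 + x ^ 5) / u ^ 5) * Real.exp (-a * x ^ 4) * (η + 1 / l) + η * (n * F) := by
    rw [← mul_sub, ← Finset.sum_sub_distrib, abs_mul, abs_of_pos hη0]
    calc η * |∑ j ∈ Finset.range n, (v j - Real.exp (-a * (s + η * j) ^ 4))|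
        ≤ η * ∑ j ∈ Finset.range n, (D * ((1 + x ^ 5) / u ^ 5) * Real.exp (-a * x ^ 4) *
            Real.exp (-l * (η * j)) + F) := by
          gcongr
          exact (Finset.abs_sum_le_sum_abs _ _).trans (Finset.sum_le_sum hterm)
      _ = D * ((1 + x ^ 5) / u ^ 5) * Real.exp (-a * x ^ 4) *
            (η * ∑ j ∈ Finset.range n, Real.exp (-l * (η * j))) + η * (n * F) := by
          rw [Finset.sum_add_distrib, ← Finset.mul_sum]
          simp
          ring
      _ ≤ _ := by
          gcongr
          exact sum_exp_grid_le hl0 hη0 n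
  have hriem := riemannSum_sub_quarticTail ha hη0.le hx hxs hsx n
  have hη3 : η * (1 + x) ^ 3 ≤ 16 / u ^ 5 := by
    calc η * (1 + x) ^ 3 ≤ 2 / u ^ 15 * (8 * u ^ 3) := by gcongr
      _ = 16 / u ^ 12 := by field_simp; norm_num
      _ ≤ 16 / u ^ 5 := by
        gcongr
        norm_num
  have hη3' : η * (1 + x) ^ 3 ≤ 16 := hη3.trans (div_le_self (by norm_num) (one_le_pow₀ hu1))
  have hηl : Real.exp (-a * x ^ 4) * (η + 1 / l) ≤ (16 + 16 / a) * G := by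
    have : Real.exp (-a * x ^ 4) * (η + 1 / l) = (η * (1 + x) ^ 3 + 16 / a) * G := by
      rw [hφ, hl]; field_simp
    rw [this]
    gcongr
  have htail : quarticTail a (s + η * n) ≤ J * Real.exp (-c₁ * u ^ 20) := by
    have h0 : 0 ≤ δ * u ^ 5 := by positivity
    refine (quarticTail_antitone ha hend).trans ((quarticTail_le ha h0).trans ?_)
    rw [mul_comm]
    refine mul_le_mul_of_nonneg_left ?_ hJ0
    rw [Real.exp_le_exp]
    have e3 : c₁ * u ^ 20 ≤ a / 2 * δ ^ 4 * u ^ 20 := by gcongr; exact min_le_right _ _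
    have e6 : (δ * u ^ 5) ^ 4 = δ ^ 4 * u ^ 20 := by ring
    rw [e6]
    linarith
  have htiny : η * (n * F) + quarticTail a (s + η * n) ≤ G / u ^ 5 := by
    have e1 : η * (n * F) ≤ 4 * (B + 1) * u ^ 40 * Real.exp (-c₁ * u ^ 20) := by
      calc η * (n * F) ≤ 2 / u ^ 15 * (2 * u ^ 20 * F) := by gcongr
        _ = 4 * (B + 1) * u ^ 15 * Real.exp (-c₁ * u ^ 20) := by rw [hF]; field_simp; norm_num
        _ ≤ _ := by
          gcongr
          norm_num
    have e2 : J * Real.exp (-c₁ * u ^ 20) ≤ J * u ^ 40 * Real.exp (-c₁ * u ^ 20) := by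
      gcongr
      exact le_mul_of_one_le_right hJ0 (one_le_pow₀ hu1)
    have e3 : Real.exp (-a * u ^ 4) ≤ Real.exp (-a * x ^ 4) :=
      exp_neg_mul_pow_four_antitone ha hx hxu
    rw [le_div_iff₀ (by positivity), hG, le_div_iff₀ (by positivity)]
    calc (η * (n * F) + quarticTail a (s + η * n)) * u ^ 5 * (1 + x) ^ 3
        ≤ (4 * (B + 1) * u ^ 40 * Real.exp (-c₁ * u ^ 20) +
            J * u ^ 40 * Real.exp (-c₁ * u ^ 20)) * u ^ 5 * (8 * u ^ 3) := by
          gcongr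
          exact htail.trans e2
      _ = 8 * (4 * (B + 1) + J) * u ^ 48 * Real.exp (-c₁ * u ^ 20) := by ring
      _ ≤ _ := hsmall.trans e3
  have hηφ : η * Real.exp (-a * x ^ 4) ≤ 16 * (G / u ^ 5) := by
    rw [hφ]
    calc η * ((1 + x) ^ 3 * G) = η * (1 + x) ^ 3 * G := by ring
      _ ≤ 16 / u ^ 5 * G := by gcongr
      _ = _ := by ring
  have hGT : G ≤ Real.exp (15 * a) * quarticTail a x := by
    have := quarticTail_lower ha hx
    calc G = Real.exp (15 * a) * (Real.exp (-15 * a) * G) := by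
          rw [← mul_assoc, ← Real.exp_add]; simp
      _ ≤ _ := by gcongr
  have hGu : G / u ^ 5 ≤ (1 + x ^ 5) / u ^ 5 * G := by
    rw [div_mul_eq_mul_div]
    gcongr
    nlinarith
  calc |η * ∑ j ∈ Finset.range n, v j - quarticTail a x|
      ≤ |η * ∑ j ∈ Finset.range n, v j -
          η * ∑ j ∈ Finset.range n, Real.exp (-a * (s + η * j) ^ 4)| +
        |η * ∑ j ∈ Finset.range n, Real.exp (-a * (s + η * j) ^ 4) - quarticTail a x| :=
        abs_sub_le _ _ _
    _ ≤ D * ((1 + x ^ 5) / u ^ 5) * (Real.exp (-a * x ^ 4) * (η + 1 / l)) + 17 * (G / u ^ 5) := by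
        linarith
    _ ≤ D * ((1 + x ^ 5) / u ^ 5) * ((16 + 16 / a) * G) + 17 * ((1 + x ^ 5) / u ^ 5 * G) := by
        gcongr
    _ = (D * (16 + 16 / a) + 17) * ((1 + x ^ 5) / u ^ 5) * G := by ring
    _ ≤ (D * (16 + 16 / a) + 17) * ((1 + x ^ 5) / u ^ 5) *
          (Real.exp (15 * a) * quarticTail a x) := by gcongr
    _ = _ := by ring

/-- The estimate `grid_tail_estimate` for the part of a full grid `t₀, t₀ + η, …` cut at `x`;
the cut is described by any decidable predicate that holds above `x` and fails below `x`. -/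
lemma full_grid_tail_estimate {a K δ c B : ℝ} (ha : 0 < a) (hK : 0 < K) (hδ : 0 < δ)
    (hKδ : 2 * K * δ ≤ a / 2) (hc : 0 < c) (hB : 0 < B) :
    ∃ C : ℝ, 0 < C ∧ ∃ u₀ : ℝ, 1 ≤ u₀ ∧ ∀ u : ℝ, u₀ ≤ u → ∀ (n : ℕ) (t₀ : ℝ) (v : ℕ → ℝ),
      t₀ ≤ 0 → (n : ℝ) ≤ 2 * u ^ 20 → δ * u ^ 5 ≤ t₀ + 2 / u ^ 15 * n →
      (∀ k < n, |t₀ + 2 / u ^ 15 * k| ≤ δ * u ^ 5 →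
        ∃ E, |E| ≤ K * (1 + |t₀ + 2 / u ^ 15 * k| ^ 5) / u ^ 5 ∧
          v k = Real.exp (-a * (t₀ + 2 / u ^ 15 * k) ^ 4 + E)) →
      (∀ k < n, δ * u ^ 5 < |t₀ + 2 / u ^ 15 * k| →
        0 ≤ v k ∧ v k ≤ B * u ^ 10 * Real.exp (-c * u ^ 20)) →
      ∀ x : ℝ, 0 ≤ x → x ≤ u →
        |2 / u ^ 15 * (∑ k ∈ Finset.range n, if x < t₀ + 2 / u ^ 15 * k then v k else 0) -
            quarticTail a x| ≤ C * ((1 + x ^ 5) / u ^ 5) * quarticTail a x ∧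
        |2 / u ^ 15 * (∑ k ∈ Finset.range n, if x ≤ t₀ + 2 / u ^ 15 * k then v k else 0) -
            quarticTail a x| ≤ C * ((1 + x ^ 5) / u ^ 5) * quarticTail a x := by
  obtain ⟨C, hC, u₀, hu₀, H⟩ := grid_tail_estimate ha hK hδ hKδ hc hB
  refine ⟨C, hC, u₀, hu₀, ?_⟩
  intro u hu n t₀ v ht₀ hn hend hv1 hv2 x hx hxu
  have hu0 : 0 < u := by linarith
  set η : ℝ := 2 / u ^ 15 with hη
  have hη0 : 0 < η := by positivity
  have main : ∀ (k₀ : ℕ) (Q : ℕ → Prop) [DecidablePred Q], (∀ k, Q k ↔ k₀ ≤ k) →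
      x ≤ t₀ + η * k₀ → t₀ + η * k₀ ≤ x + η →
      |η * (∑ k ∈ Finset.range n, if Q k then v k else 0) - quarticTail a x| ≤
        C * ((1 + x ^ 5) / u ^ 5) * quarticTail a x := by
    intro k₀ Q _ hQ hk1 hk2
    have hpt : ∀ j : ℕ, t₀ + η * k₀ + η * j = t₀ + η * ((k₀ + j : ℕ) : ℝ) := by
      intro j; push_cast; ring
    have hsum : (∑ k ∈ Finset.range n, if Q k then v k else 0) =
        ∑ j ∈ Finset.range (n - k₀), v (k₀ + j) := by
      rw [← Finset.sum_filter, ← Finset.sum_Ico_eq_sum_range]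
      congr 1
      ext k
      simp [hQ]
      tauto
    rw [hsum]
    apply H u hu (n - k₀) (t₀ + η * k₀) x (fun j => v (k₀ + j)) hx hxu hk1 hk2
    · refine le_trans ?_ hn
      exact_mod_cast Nat.sub_le _ _
    · rw [hpt]
      refine hend.trans ?_
      gcongr
      omega
    · intro j hj
      rw [hpt]
      intro h
      have hpos : 0 ≤ t₀ + η * ((k₀ + j : ℕ) : ℝ) := by
        rw [← hpt]; have : 0 ≤ η * j := by positivity
        linarith
      have := hv1 (k₀ + j) (by omega) (by rwa [abs_of_nonneg hpos])
      rwa [abs_of_nonneg hpos] at this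
    · intro j hj
      rw [hpt]
      intro h
      exact hv2 (k₀ + j) (by omega) (h.trans_le (le_abs_self _))
  constructor
  · have hnn : 0 ≤ (x - t₀) / η := div_nonneg (by linarith) hη0.le
    apply main (⌊(x - t₀) / η⌋₊ + 1) (fun k => x < t₀ + η * k)
    · intro k
      rw [Nat.succ_le_iff, Nat.floor_lt hnn, div_lt_iff₀ hη0]
      constructor <;> intro h <;> linarith
    · have := Nat.lt_floor_add_one ((x - t₀) / η)
      rw [div_lt_iff₀ hη0] at this
      push_cast
      linarith
    · have := Nat.floor_le hnn
      rw [le_div_iff₀ hη0] at this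
      push_cast
      linarith
  · have hnn : 0 ≤ (x - t₀) / η := div_nonneg (by linarith) hη0.le
    apply main (⌈(x - t₀) / η⌉₊) (fun k => x ≤ t₀ + η * k)
    · intro k
      rw [Nat.ceil_le, div_le_iff₀ hη0]
      constructor <;> intro h <;> linarith
    · have := Nat.le_ceil ((x - t₀) / η)
      rw [div_le_iff₀ hη0] at this
      linarith
    · have := Nat.ceil_lt_add_one hnn
      rw [← sub_lt_iff_lt_add, lt_div_iff₀ hη0] at this
      linarith

/-- The derivative of `Hfun (q + 3) β h` on `(-1, 1)`. -/
def HfunD1 (q : ℕ) (β h x : ℝ) : ℝ :=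
  β * (q + 3) * x ^ (q + 2) + h - (1 / 2) * (Real.log (1 + x) - Real.log (1 - x))

/-- The second derivative of `Hfun (q + 3) β h` on `(-1, 1)`. -/
def HfunD2 (q : ℕ) (β x : ℝ) : ℝ :=
  β * (q + 3) * (q + 2) * x ^ (q + 1) - (1 / 2) * ((1 + x)⁻¹ + (1 - x)⁻¹)

/-- The third derivative of `Hfun (q + 3) β h` on `(-1, 1)`. -/
def HfunD3 (q : ℕ) (β x : ℝ) : ℝ :=
  β * (q + 3) * (q + 2) * (q + 1) * x ^ q - (1 / 2) * (-((1 + x) ^ 2)⁻¹ + ((1 - x) ^ 2)⁻¹)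

/-- The fourth derivative of `Hfun (q + 3) β h` on `(-1, 1)`. -/
def HfunD4 (q : ℕ) (β x : ℝ) : ℝ :=
  β * (q + 3) * (q + 2) * (q + 1) * (q * x ^ (q - 1)) - (((1 + x) ^ 3)⁻¹ + ((1 - x) ^ 3)⁻¹)

section Derivatives

variable {q : ℕ} {β h x : ℝ}

lemma hasDerivAt_one_add (x : ℝ) : HasDerivAt (fun y : ℝ => 1 + y) 1 x := by
  simpa using (hasDerivAt_id x).const_add 1

lemma hasDerivAt_one_sub (x : ℝ) : HasDerivAt (fun y : ℝ => 1 - y) (-1) x := by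
  simpa using (hasDerivAt_id x).const_sub 1

lemma hasDerivAt_Hfun (hx : x ∈ Set.Ioo (-1 : ℝ) 1) :
    HasDerivAt (Hfun (q + 3) β h) (HfunD1 q β h x) x := by
  have h1 : 1 + x ≠ 0 := by linarith [hx.1]
  have h2 : 1 - x ≠ 0 := by linarith [hx.2]
  have d1 := (hasDerivAt_one_add x).mul ((hasDerivAt_one_add x).log h1)
  have d2 := (hasDerivAt_one_sub x).mul ((hasDerivAt_one_sub x).log h2)
  have d3 := ((d1.add d2).const_mul (1 / 2 : ℝ))
  have d4 := ((((hasDerivAt_pow (q + 3) x).const_mul β).add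
    ((hasDerivAt_id x).const_mul h)).sub d3)
  refine d4.congr_deriv ?_
  rw [HfunD1]
  push_cast
  field_simp
  ring

lemma hasDerivAt_HfunD1 (hx : x ∈ Set.Ioo (-1 : ℝ) 1) :
    HasDerivAt (HfunD1 q β h) (HfunD2 q β x) x := by
  have h1 : 1 + x ≠ 0 := by linarith [hx.1]
  have h2 : 1 - x ≠ 0 := by linarith [hx.2]
  have d3 := (((hasDerivAt_one_add x).log h1).sub ((hasDerivAt_one_sub x).log h2)).const_mul
    (1 / 2 : ℝ)
  have d4 := (((hasDerivAt_pow (q + 2) x).const_mul (β * (q + 3))).add_const h).sub d3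
  refine d4.congr_deriv ?_
  rw [HfunD2, show q + 2 - 1 = q + 1 by omega]
  push_cast
  field_simp
  ring

lemma hasDerivAt_HfunD2 (hx : x ∈ Set.Ioo (-1 : ℝ) 1) :
    HasDerivAt (HfunD2 q β) (HfunD3 q β x) x := by
  have h1 : 1 + x ≠ 0 := by linarith [hx.1]
  have h2 : 1 - x ≠ 0 := by linarith [hx.2]
  have d3 := (((hasDerivAt_one_add x).inv h1).add ((hasDerivAt_one_sub x).inv h2)).const_mul
    (1 / 2 : ℝ)
  have d4 := ((hasDerivAt_pow (q + 1) x).const_mul (β * (q + 3) * (q + 2))).sub d3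
  refine d4.congr_deriv ?_
  rw [HfunD3, show q + 1 - 1 = q by omega]
  push_cast
  field_simp

lemma hasDerivAt_HfunD3 (hx : x ∈ Set.Ioo (-1 : ℝ) 1) :
    HasDerivAt (HfunD3 q β) (HfunD4 q β x) x := by
  have h1 : 1 + x ≠ 0 := by linarith [hx.1]
  have h2 : 1 - x ≠ 0 := by linarith [hx.2]
  have d3 := ((((hasDerivAt_one_add x).pow 2).inv (pow_ne_zero 2 h1)).neg.add
    (((hasDerivAt_one_sub x).pow 2).inv (pow_ne_zero 2 h2))).const_mul (1 / 2 : ℝ)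
  have d4 := ((hasDerivAt_pow q x).const_mul (β * (q + 3) * (q + 2) * (q + 1))).sub d3
  refine d4.congr_deriv ?_
  rw [HfunD4]
  simp only [Pi.pow_apply]
  field_simp
  ring

lemma differentiableAt_HfunD4 (hx : x ∈ Set.Ioo (-1 : ℝ) 1) :
    DifferentiableAt ℝ (HfunD4 q β) x := by
  have h1 : (1 + x) ^ 3 ≠ 0 := pow_ne_zero _ (by linarith [hx.1])
  have h2 : (1 - x) ^ 3 ≠ 0 := pow_ne_zero _ (by linarith [hx.2])
  unfold HfunD4
  fun_prop (disch := assumption)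

lemma iteratedDeriv_Hfun (hx : x ∈ Set.Ioo (-1 : ℝ) 1) :
    iteratedDeriv 2 (Hfun (q + 3) β h) x = HfunD2 q β x ∧
      iteratedDeriv 4 (Hfun (q + 3) β h) x = HfunD4 q β x := by
  have step : ∀ (n : ℕ) (f g g' : ℝ → ℝ),
      (∀ y ∈ Set.Ioo (-1 : ℝ) 1, iteratedDeriv n f y = g y) →
      (∀ y ∈ Set.Ioo (-1 : ℝ) 1, HasDerivAt g (g' y) y) →
      ∀ y ∈ Set.Ioo (-1 : ℝ) 1, iteratedDeriv (n + 1) f y = g' y := by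
    intro n f g g' h1 h2 y hy
    rw [iteratedDeriv_succ, ← (h2 y hy).deriv]
    apply Filter.EventuallyEq.deriv_eq
    filter_upwards [isOpen_Ioo.mem_nhds hy] with z hz using h1 z hz
  have s1 := step 0 (Hfun (q + 3) β h) _ (HfunD1 q β h) (fun y _ => by simp)
    fun y hy => hasDerivAt_Hfun hy
  have s2 := step 1 _ _ _ s1 fun y hy => hasDerivAt_HfunD1 hy
  have s3 := step 2 _ _ _ s2 fun y hy => hasDerivAt_HfunD2 hy
  have s4 := step 3 _ _ _ s3 fun y hy => hasDerivAt_HfunD3 hy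
  exact ⟨s2 x hx, s4 x hx⟩

end Derivatives

lemma abs_le_of_abs_deriv_le {f f' : ℝ → ℝ} {m δ C : ℝ} {n : ℕ}
    (hd : ∀ y, |y - m| ≤ δ → HasDerivAt f (f' y) y) (hf : f m = 0) (hC : 0 ≤ C)
    (hb : ∀ y, |y - m| ≤ δ → |f' y| ≤ C * |y - m| ^ n) :
    ∀ y, |y - m| ≤ δ → |f y| ≤ C * |y - m| ^ (n + 1) := by
  intro y hy
  have hball : ∀ z ∈ Metric.closedBall m |y - m|, |z - m| ≤ |y - m| := by
    intro z hz; simpa [Real.dist_eq] using hz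
  have := (convex_closedBall m |y - m|).norm_image_sub_le_of_norm_hasDerivWithin_le
    (f := f) (f' := f') (C := C * |y - m| ^ n) (x := m) (y := y)
    (fun z hz => (hd z ((hball z hz).trans hy)).hasDerivWithinAt)
    (fun z hz => by
      rw [Real.norm_eq_abs]
      refine (hb z ((hball z hz).trans hy)).trans ?_
      have := hball z hz
      gcongr)
    (by simp) (by simp [Real.dist_eq])
  rw [hf, sub_zero, Real.norm_eq_abs, Real.norm_eq_abs] at this
  rw [pow_succ, ← mul_assoc]
  exact this

lemma DifferentiableAt.exists_abs_sub_le {f : ℝ → ℝ} {m : ℝ} (hf : DifferentiableAt ℝ f m) :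
    ∃ K > 0, ∃ δ > 0, ∀ y, |y - m| ≤ δ → |f y - f m| ≤ K * |y - m| ^ 1 := by
  obtain ⟨K, hK, hb⟩ := hf.isBigO_sub.exists_pos
  obtain ⟨δ, hδ, h⟩ := Metric.eventually_nhds_iff.1 hb.bound
  refine ⟨K, hK, δ / 2, by positivity, fun y hy => ?_⟩
  have := h (y := y) (by rw [Real.dist_eq]; linarith)
  simpa using this

section Special

variable {q : ℕ} {β h m : ℝ}

lemma exists_ball_subset_Ioo (hm : m ∈ Set.Ioo (-1 : ℝ) 1) :
    ∃ δ > 0, ∀ y, |y - m| ≤ δ → y ∈ Set.Ioo (-1 : ℝ) 1 := by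
  obtain ⟨δ, hδ, h⟩ := Metric.isOpen_iff.1 isOpen_Ioo m hm
  refine ⟨δ / 2, by positivity, fun y hy => h ?_⟩
  rw [Metric.mem_ball, Real.dist_eq]
  linarith

lemma HfunD1_eq_zero (hmax : isMaximizer (q + 3) β h m) : HfunD1 q β h m = 0 := by
  refine IsLocalMax.hasDerivAt_eq_zero ?_ (hasDerivAt_Hfun hmax.1)
  filter_upwards [isOpen_Ioo.mem_nhds hmax.1] with y hy
  exact hmax.2 y (Set.Ioo_subset_Icc_self hy)

lemma HfunD3_eq_zero (hmax : isMaximizer (q + 3) β h m) (h2 : HfunD2 q β m = 0) :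
    HfunD3 q β m = 0 := by
  obtain ⟨K, hK, δ₁, hδ₁, hb⟩ :=
    (hasDerivAt_HfunD3 (q := q) (β := β) hmax.1).differentiableAt.exists_abs_sub_le
  obtain ⟨δ₂, hδ₂, hI⟩ := exists_ball_subset_Ioo hmax.1
  set b := HfunD3 q β m with hbdef
  set δ := min δ₁ δ₂ with hδ
  have hδ0 : 0 < δ := lt_min hδ₁ hδ₂
  have hI' : ∀ y, |y - m| ≤ δ → y ∈ Set.Ioo (-1 : ℝ) 1 :=
    fun y hy => hI y (hy.trans (min_le_right _ _))
  have hid : ∀ y : ℝ, HasDerivAt (fun y => y - m) 1 y := fun y => (hasDerivAt_id y).sub_const m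
  have b2 := abs_le_of_abs_deriv_le (f := fun y => HfunD2 q β y - b * (y - m))
    (f' := fun y => HfunD3 q β y - b) (m := m) (δ := δ) (n := 1)
    (fun y hy => ((hasDerivAt_HfunD2 (hI' y hy)).sub ((hid y).const_mul b)).congr_deriv (by ring))
    (by simp [h2]) hK.le (fun y hy => hb y (hy.trans (min_le_left _ _)))
  have b1 := abs_le_of_abs_deriv_le (f := fun y => HfunD1 q β h y - b / 2 * (y - m) ^ 2)
    (m := m) (δ := δ)
    (fun y hy => ((hasDerivAt_HfunD1 (hI' y hy)).sub (((hid y).pow 2).const_mul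
      (b / 2))).congr_deriv (by simp; ring))
    (by simp [HfunD1_eq_zero hmax]) hK.le b2
  have b0 := abs_le_of_abs_deriv_le
    (f := fun y => (Hfun (q + 3) β h y - Hfun (q + 3) β h m) - b / 6 * (y - m) ^ 3)
    (m := m) (δ := δ)
    (fun y hy => (((hasDerivAt_Hfun (hI' y hy)).sub_const _).sub (((hid y).pow 3).const_mul
      (b / 6))).congr_deriv (by simp; ring))
    (by simp) hK.le b1
  have key : ∀ t : ℝ, |t| ≤ δ → b / 6 * t ^ 3 ≤ K * |t| ^ 4 := by
    intro t ht
    have hy : |m + t - m| ≤ δ := by rwa [add_sub_cancel_left]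
    have h1 := hmax.2 (m + t) (Set.Ioo_subset_Icc_self (hI' _ hy))
    have h3 := (abs_le.1 (b0 (m + t) hy)).1
    simp only [add_sub_cancel_left] at h3
    norm_num at h3
    linarith
  by_contra hne
  have hbpos : 0 < |b| := abs_pos.2 hne
  set t₁ := min δ (|b| / (12 * K)) with ht₁
  have ht0 : 0 < t₁ := lt_min hδ0 (by positivity)
  have ht2 : t₁ * (12 * K) ≤ |b| := by
    rw [← le_div_iff₀ (by positivity)]; exact min_le_right _ _
  have h5 : |b| / 6 * t₁ ^ 3 ≤ K * t₁ ^ 4 := by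
    rcases lt_or_gt_of_ne hne with hneg | hpos
    · have := key (-t₁) (by rw [abs_neg, abs_of_pos ht0]; exact min_le_left _ _)
      rw [abs_neg, abs_of_pos ht0] at this
      rw [abs_of_neg hneg]
      linarith
    · have := key t₁ (by rw [abs_of_pos ht0]; exact min_le_left _ _)
      rw [abs_of_pos ht0] at this
      rwa [abs_of_pos hpos]
  have h6 : 0 < t₁ ^ 3 := by positivity
  nlinarith

lemma HfunD4_neg (hm : m ∈ Set.Ioo (-1 : ℝ) 1) (h2 : HfunD2 q β m = 0)
    (h3 : HfunD3 q β m = 0) : HfunD4 q β m < 0 := by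
  have e1 : 0 < 1 + m := by linarith [hm.1]
  have e2 : 0 < 1 - m := by linarith [hm.2]
  have hm0 : m ≠ 0 := by
    rintro rfl
    norm_num [HfunD2] at h2
  have hm2 : 0 < m ^ 2 := by positivity
  set w : ℝ := (1 + m) * (1 - m) with hw
  have hw0 : 0 < w := mul_pos e1 e2
  set P : ℝ := β * (q + 3) * (q + 2) * m ^ (q + 1) with hP
  have f2 : P * w = 1 := by
    rw [HfunD2, ← hP] at h2
    have : P = (1 / 2) * ((1 + m)⁻¹ + (1 - m)⁻¹) := by linarith
    rw [this, hw]; field_simp; ring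
  have f3 : (q + 1) * P * w ^ 2 = 2 * m ^ 2 := by
    have : (q + 1) * P = m * ((1 / 2) * (-((1 + m) ^ 2)⁻¹ + ((1 - m) ^ 2)⁻¹)) := by
      have : (q + 1) * P = m * (β * (q + 3) * (q + 2) * (q + 1) * m ^ q) := by rw [hP]; ring
      rw [this]
      rw [HfunD3] at h3
      congr 1
      linarith
    rw [this, hw]; field_simp; ring
  have f3' : (q + 1) * w = 2 * m ^ 2 := by
    calc (q + 1) * w = (q + 1) * w * (P * w) := by rw [f2, mul_one]
      _ = (q + 1) * P * w ^ 2 := by ring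
      _ = _ := f3
  have f4 : m ^ 2 * HfunD4 q β m * w ^ 3 = -4 * m ^ 2 := by
    have g1 : m ^ 2 * (β * (q + 3) * (q + 2) * (q + 1) * (q * m ^ (q - 1))) = q * (q + 1) * P := by
      rcases Nat.eq_zero_or_pos q with h0 | h0
      · simp [h0]
      · have : m ^ (q + 1) = m ^ 2 * m ^ (q - 1) := by rw [← pow_add]; congr 1; omega
        rw [hP, this]; ring
    have g2 : (((1 + m) ^ 3)⁻¹ + ((1 - m) ^ 3)⁻¹) * w ^ 3 = 2 + 6 * m ^ 2 := by
      rw [hw]; field_simp; ring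
    have g3 : q * w = 3 * m ^ 2 - 1 := by
      have : w = 1 - m ^ 2 := by rw [hw]; ring
      linarith
    calc m ^ 2 * HfunD4 q β m * w ^ 3
        = m ^ 2 * (β * (q + 3) * (q + 2) * (q + 1) * (q * m ^ (q - 1))) * w ^ 3 -
          m ^ 2 * ((((1 + m) ^ 3)⁻¹ + ((1 - m) ^ 3)⁻¹) * w ^ 3) := by rw [HfunD4]; ring
      _ = (q * w) * ((q + 1) * w) * (P * w) - m ^ 2 * (2 + 6 * m ^ 2) := by rw [g1, g2]; ring
      _ = _ := by rw [g3, f3', f2]; ring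
  by_contra hcon
  have : 0 ≤ m ^ 2 * HfunD4 q β m * w ^ 3 := by
    have := not_lt.1 hcon
    positivity
  linarith

lemma Hfun_quartic_expansion (hmax : isMaximizer (q + 3) β h m) (h2 : HfunD2 q β m = 0) :
    ∃ K > 0, ∃ δ > 0, ∀ y, |y - m| ≤ δ →
      |Hfun (q + 3) β h y - Hfun (q + 3) β h m - HfunD4 q β m / 24 * (y - m) ^ 4| ≤
        K * |y - m| ^ 5 := by
  obtain ⟨K, hK, δ₁, hδ₁, hb⟩ :=
    (differentiableAt_HfunD4 (q := q) (β := β) hmax.1).exists_abs_sub_le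
  obtain ⟨δ₂, hδ₂, hI⟩ := exists_ball_subset_Ioo hmax.1
  set b := HfunD4 q β m with hbdef
  set δ := min δ₁ δ₂ with hδ
  have hδ0 : 0 < δ := lt_min hδ₁ hδ₂
  have hI' : ∀ y, |y - m| ≤ δ → y ∈ Set.Ioo (-1 : ℝ) 1 :=
    fun y hy => hI y (hy.trans (min_le_right _ _))
  have hid : ∀ y : ℝ, HasDerivAt (fun y => y - m) 1 y := fun y => (hasDerivAt_id y).sub_const m
  have b3 := abs_le_of_abs_deriv_le (f := fun y => HfunD3 q β y - b * (y - m))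
    (f' := fun y => HfunD4 q β y - b) (m := m) (δ := δ) (n := 1)
    (fun y hy => ((hasDerivAt_HfunD3 (hI' y hy)).sub ((hid y).const_mul b)).congr_deriv (by ring))
    (by simp [HfunD3_eq_zero hmax h2]) hK.le (fun y hy => hb y (hy.trans (min_le_left _ _)))
  have b2 := abs_le_of_abs_deriv_le (f := fun y => HfunD2 q β y - b / 2 * (y - m) ^ 2)
    (m := m) (δ := δ)
    (fun y hy => ((hasDerivAt_HfunD2 (hI' y hy)).sub (((hid y).pow 2).const_mul
      (b / 2))).congr_deriv (by simp; ring))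
    (by simp [h2]) hK.le b3
  have b1 := abs_le_of_abs_deriv_le (f := fun y => HfunD1 q β h y - b / 6 * (y - m) ^ 3)
    (m := m) (δ := δ)
    (fun y hy => ((hasDerivAt_HfunD1 (hI' y hy)).sub (((hid y).pow 3).const_mul
      (b / 6))).congr_deriv (by simp; ring))
    (by simp [HfunD1_eq_zero hmax]) hK.le b2
  have b0 := abs_le_of_abs_deriv_le
    (f := fun y => (Hfun (q + 3) β h y - Hfun (q + 3) β h m) - b / 24 * (y - m) ^ 4)
    (m := m) (δ := δ)
    (fun y hy => (((hasDerivAt_Hfun (hI' y hy)).sub_const _).sub (((hid y).pow 4).const_mul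
      (b / 24))).congr_deriv (by simp; ring))
    (by simp) hK.le b1
  exact ⟨K, hK, δ, hδ0, b0⟩

lemma continuous_Hfun (p : ℕ) (β h : ℝ) : Continuous (Hfun p β h) := by
  have h1 : Continuous fun x : ℝ => (1 + x) * Real.log (1 + x) :=
    Real.continuous_mul_log.comp (by fun_prop : Continuous fun x : ℝ => 1 + x)
  have h2 : Continuous fun x : ℝ => (1 - x) * Real.log (1 - x) :=
    Real.continuous_mul_log.comp (by fun_prop : Continuous fun x : ℝ => 1 - x)
  unfold Hfun binEnt
  fun_prop

lemma exists_Hfun_one_lt (hβ : 0 < β) (hh : 0 < h) :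
    ∃ x ∈ Set.Icc (-1 : ℝ) 1, Hfun (q + 3) β h 1 < Hfun (q + 3) β h x := by
  set M : ℝ := β * (q + 3) + h with hM
  have hM0 : 0 < M := by positivity
  set e : ℝ := Real.exp (-2 * M - 1) with he
  have he0 : 0 < e := Real.exp_pos _
  have he1 : e < 1 := by rw [he, Real.exp_lt_one_iff]; linarith
  refine ⟨1 - e, ⟨by linarith, by linarith⟩, ?_⟩
  refine strictAntiOn_of_deriv_neg (convex_Icc (1 - e) 1) (continuous_Hfun _ _ _).continuousOn
    ?_ (Set.left_mem_Icc.2 (by linarith)) (Set.right_mem_Icc.2 (by linarith)) (by linarith)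
  intro x hx
  rw [interior_Icc] at hx
  rw [(hasDerivAt_Hfun ⟨by linarith [hx.1], hx.2⟩).deriv, HfunD1]
  have l1 : 0 ≤ Real.log (1 + x) := Real.log_nonneg (by linarith [hx.1])
  have l2 : Real.log (1 - x) < -2 * M - 1 := by
    rw [Real.log_lt_iff_lt_exp (by linarith [hx.2])]; linarith [hx.1]
  have l3 : β * (q + 3) * x ^ (q + 2) ≤ β * (q + 3) * 1 := by
    gcongr
    exact pow_le_one₀ (by linarith [hx.1]) hx.2.le
  linarith

lemma exists_Hfun_neg_one_lt (hβ : 0 < β) (hh : 0 < h) :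
    ∃ x ∈ Set.Icc (-1 : ℝ) 1, Hfun (q + 3) β h (-1) < Hfun (q + 3) β h x := by
  set M : ℝ := β * (q + 3) + h with hM
  have hM0 : 0 < M := by positivity
  set e : ℝ := Real.exp (-2 * M - 1) with he
  have he0 : 0 < e := Real.exp_pos _
  have he1 : e < 1 := by rw [he, Real.exp_lt_one_iff]; linarith
  refine ⟨-1 + e, ⟨by linarith, by linarith⟩, ?_⟩
  refine strictMonoOn_of_deriv_pos (convex_Icc (-1) (-1 + e))
    (continuous_Hfun _ _ _).continuousOn
    ?_ (Set.left_mem_Icc.2 (by linarith)) (Set.right_mem_Icc.2 (by linarith)) (by linarith)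
  intro x hx
  rw [interior_Icc] at hx
  rw [(hasDerivAt_Hfun ⟨hx.1, by linarith [hx.2]⟩).deriv, HfunD1]
  have l1 : 0 ≤ Real.log (1 - x) := Real.log_nonneg (by linarith [hx.2])
  have l2 : Real.log (1 + x) < -2 * M - 1 := by
    rw [Real.log_lt_iff_lt_exp (by linarith [hx.1])]; linarith [hx.2]
  have l4 : |x ^ (q + 2)| ≤ 1 := by
    rw [abs_pow]
    exact pow_le_one₀ (abs_nonneg _) (abs_le.2 ⟨hx.1.le, by linarith [hx.2]⟩)
  have l3 : β * (q + 3) * (-1) ≤ β * (q + 3) * x ^ (q + 2) := by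
    gcongr
    exact (abs_le.1 l4).1
  linarith

/-- Away from its unique maximizer, `Hfun` stays below its maximum by a definite gap. -/
lemma Hfun_gap (hβ : 0 < β) (hh : 0 < h) (hm : isUniqueMaximizer (q + 3) β h m)
    {δ : ℝ} (hδ : 0 < δ) : ∃ c > 0, ∀ y ∈ Set.Icc (-1 : ℝ) 1, δ < |y - m| →
      Hfun (q + 3) β h y ≤ Hfun (q + 3) β h m - c := by
  set S : Set ℝ := Set.Icc (-1 : ℝ) 1 ∩ {y | δ ≤ |y - m|} with hS
  have hScpt : IsCompact S :=
    isCompact_Icc.inter_right (isClosed_le continuous_const (by fun_prop))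
  rcases S.eq_empty_or_nonempty with hE | hne
  · refine ⟨1, one_pos, fun y hy hyd => ?_⟩
    have : y ∈ S := ⟨hy, hyd.le⟩
    rw [hE] at this
    exact this.elim
  obtain ⟨y₀, hy₀, hy₀max⟩ := hScpt.exists_isMaxOn hne (continuous_Hfun (q + 3) β h).continuousOn
  have hlt : Hfun (q + 3) β h y₀ < Hfun (q + 3) β h m := by
    refine lt_of_le_of_ne (hm.1.2 y₀ hy₀.1) fun heq => ?_
    have hall : ∀ x ∈ Set.Icc (-1 : ℝ) 1, Hfun (q + 3) β h x ≤ Hfun (q + 3) β h y₀ :=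
      fun x hx => heq ▸ hm.1.2 x hx
    have h1 : y₀ ≠ 1 := by
      rintro rfl
      obtain ⟨x, hx, hlt⟩ := exists_Hfun_one_lt (q := q) hβ hh
      exact absurd (hall x hx) (not_le.2 hlt)
    have h2 : y₀ ≠ -1 := by
      rintro rfl
      obtain ⟨x, hx, hlt⟩ := exists_Hfun_neg_one_lt (q := q) hβ hh
      exact absurd (hall x hx) (not_le.2 hlt)
    have h3 := hm.2 y₀ ⟨⟨lt_of_le_of_ne hy₀.1.1 h2.symm, lt_of_le_of_ne hy₀.1.2 h1⟩, hall⟩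
    have h4 : δ ≤ |y₀ - m| := hy₀.2
    rw [h3] at h4
    simp at h4
    linarith
  refine ⟨Hfun (q + 3) β h m - Hfun (q + 3) β h y₀, by linarith, fun y hy hyd => ?_⟩
  have : Hfun (q + 3) β h y ≤ Hfun (q + 3) β h y₀ := hy₀max (⟨hy, hyd.le⟩ : y ∈ S)
  linarith

end Special

lemma log_stirlingSeq_bounds {n : ℕ} (hn : 0 < n) :
    0 ≤ Real.log (Stirling.stirlingSeq n) - Real.log √π ∧
      Real.log (Stirling.stirlingSeq n) - Real.log √π ≤ 1 / (12 * n) := by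
  have hpi : 0 < √π := Real.sqrt_pos.2 Real.pi_pos
  constructor
  · have := Real.log_le_log hpi (Stirling.sqrt_pi_le_stirlingSeq hn.ne')
    linarith
  · let f : ℕ → ℝ := fun j => Real.log (Stirling.stirlingSeq (n + j)) - 1 / (12 * (n + j : ℕ))
    have hmono : Monotone f := by
      apply monotone_nat_of_le_succ
      intro j
      have h1 := Stirling.log_stirlingSeq_sdiff_le (n + j)
      have hpos : (0 : ℝ) < (n + j : ℕ) := by exact_mod_cast (by omega : 0 < n + j)
      have h2 : (1 : ℝ) / (12 * (n + j : ℕ) * ((n + j : ℕ) + 1)) =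
          1 / (12 * (n + j : ℕ)) - 1 / (12 * ((n + j : ℕ) + 1)) := by
        field_simp; ring
      rw [h2] at h1
      simp only [f, ← add_assoc]
      push_cast at h1 ⊢
      linarith
    have hshift : Tendsto (fun j : ℕ => n + j) atTop atTop :=
      tendsto_atTop_mono (fun j => Nat.le_add_left j n) tendsto_id
    have hlim1 : Tendsto (fun j : ℕ => Real.log (Stirling.stirlingSeq (n + j))) atTop
        (𝓝 (Real.log √π)) :=
      ((Real.continuousAt_log hpi.ne').tendsto.comp Stirling.tendsto_stirlingSeq_sqrt_pi).comp
        hshift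
    have hlim2 : Tendsto (fun j : ℕ => 1 / (12 * ((n + j : ℕ) : ℝ))) atTop (𝓝 0) := by
      have h0 : Tendsto (fun j : ℕ => (12 : ℝ) * ((n + j : ℕ) : ℝ)) atTop atTop :=
        (tendsto_natCast_atTop_atTop.comp hshift).const_mul_atTop (by norm_num)
      exact h0.inv_tendsto_atTop.congr fun j => by simp [one_div]
    have hlim := hlim1.sub hlim2
    rw [sub_zero] at hlim
    have := hmono.ge_of_tendsto hlim 0
    simp only [f, add_zero] at this
    linarith

lemma entropy_eq {N k : ℕ} (hN : 0 < N) (hk : k ≤ N) :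
    N * Real.log 2 - N * binEnt ((2 * k - N) / N) =
      -(k * Real.log (k / N) + ((N - k : ℕ) : ℝ) * Real.log ((N - k : ℕ) / N)) := by
  have hN' : (0 : ℝ) < N := by exact_mod_cast hN
  have key : ∀ j : ℕ, (j : ℝ) * Real.log (2 * (j / N)) =
      j * Real.log 2 + j * Real.log (j / N) := by
    intro j
    rcases Nat.eq_zero_or_pos j with rfl | hj
    · simp
    · have : (0 : ℝ) < j := by exact_mod_cast hj
      rw [Real.log_mul (by norm_num) (by positivity)]
      ring
  have e1 : 1 + (2 * (k : ℝ) - N) / N = 2 * (k / N) := by field_simp; ring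
  have e2 : 1 - (2 * (k : ℝ) - N) / N = 2 * ((N - k : ℕ) / N) := by
    rw [Nat.cast_sub hk]; field_simp; ring
  have e3 : N * binEnt ((2 * k - N) / N) =
      k * Real.log (2 * (k / N)) + ((N - k : ℕ) : ℝ) * Real.log (2 * ((N - k : ℕ) / N)) := by
    rw [binEnt, e1, e2]
    field_simp
  rw [e3, key, key]
  rw [Nat.cast_sub hk]
  ring

lemma choose_le_exp_entropy {N k : ℕ} (hN : 0 < N) (hk : k ≤ N) :
    (N.choose k : ℝ) ≤ Real.exp (N * Real.log 2 - N * binEnt ((2 * k - N) / N)) := by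
  have hN' : (0 : ℝ) < N := by exact_mod_cast hN
  rw [entropy_eq hN hk, Real.exp_neg, Real.exp_add]
  have hpow : ∀ j : ℕ, Real.exp (j * Real.log (j / N)) = ((j : ℝ) / N) ^ j := by
    intro j
    rcases Nat.eq_zero_or_pos j with rfl | hj
    · simp
    · have : (0 : ℝ) < j := by exact_mod_cast hj
      rw [Real.exp_nat_mul, Real.exp_log (by positivity)]
  have hpos : 0 < Real.exp (k * Real.log (k / N)) *
      Real.exp (((N - k : ℕ) : ℝ) * Real.log ((N - k : ℕ) / N)) := by positivity
  rw [← one_div, le_div_iff₀ hpos, hpow, hpow]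
  have hbin := add_pow ((k : ℝ) / N) ((N - k : ℕ) / N) N
  have h1 : (k : ℝ) / N + (N - k : ℕ) / N = 1 := by
    rw [Nat.cast_sub hk]; field_simp; ring
  rw [h1, one_pow] at hbin
  rw [hbin]
  have := Finset.single_le_sum (f := fun m => ((k : ℝ) / N) ^ m * ((N - k : ℕ) / N : ℝ) ^ (N - m) *
    (N.choose m : ℝ)) (s := Finset.range (N + 1)) (fun i _ => by positivity)
    (Finset.mem_range.2 (Nat.lt_succ_of_le hk))
  refine le_trans (le_of_eq ?_) this
  ring

lemma log_choose_eq {N k : ℕ} (hk0 : 0 < k) (hk : k < N) :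
    Real.log (N.choose k) = N * Real.log 2 - N * binEnt ((2 * k - N) / N) +
      1 / 2 * Real.log (2 / N) - 1 / 2 * Real.log (1 - ((2 * k - N) / N) ^ 2) +
      Real.log (Stirling.stirlingSeq N) - Real.log (Stirling.stirlingSeq k) -
      Real.log (Stirling.stirlingSeq (N - k)) := by
  have hN : 0 < N := by omega
  have hN' : (0 : ℝ) < N := by exact_mod_cast hN
  have hk' : (0 : ℝ) < k := by exact_mod_cast hk0
  have hNk : (0 : ℝ) < (N - k : ℕ) := by exact_mod_cast (by omega : 0 < N - k)
  have hfac : Real.log (N.choose k) = Real.log N.factorial - Real.log k.factorial -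
      Real.log (N - k).factorial := by
    rw [← Nat.choose_mul_factorial_mul_factorial hk.le]
    have h1 : ((N.choose k : ℕ) : ℝ) ≠ 0 := by
      exact_mod_cast (Nat.choose_pos hk.le).ne'
    have h2 : ((k.factorial : ℕ) : ℝ) ≠ 0 := by exact_mod_cast k.factorial_ne_zero
    have h3 : (((N - k).factorial : ℕ) : ℝ) ≠ 0 := by exact_mod_cast (N - k).factorial_ne_zero
    push_cast
    rw [Real.log_mul (by positivity) h3, Real.log_mul h1 h2]
    ring
  have h1 : 1 - ((2 * (k : ℝ) - N) / N) ^ 2 = 4 * k * (N - k : ℕ) / N ^ 2 := by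
    rw [Nat.cast_sub hk.le]; field_simp; ring
  rw [entropy_eq hN hk.le, hfac, Stirling.log_stirlingSeq_formula, Stirling.log_stirlingSeq_formula,
    Stirling.log_stirlingSeq_formula, h1]
  have he : Real.exp 1 ≠ 0 := (Real.exp_pos 1).ne'
  have h4 : Real.log 4 = 2 * Real.log 2 := by
    rw [show (4 : ℝ) = 2 ^ 2 by norm_num, Real.log_pow]; norm_num
  rw [Real.log_div hN'.ne' he, Real.log_div hk'.ne' he, Real.log_div hNk.ne' he,
    Real.log_div hk'.ne' hN'.ne', Real.log_div hNk.ne' hN'.ne', Real.log_div two_ne_zero hN'.ne',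
    Real.log_div (by positivity) (by positivity), Real.log_mul (by positivity) hNk.ne',
    Real.log_mul (by positivity) hk'.ne', Real.log_mul two_ne_zero hN'.ne',
    Real.log_mul two_ne_zero hk'.ne', Real.log_mul two_ne_zero hNk.ne', Real.log_pow, h4,
    Real.log_exp]
  rw [Nat.cast_sub hk.le]
  push_cast
  ring

/-- The total Gibbs weight of the configurations with exactly `k` positive spins. -/
def levelWeight (p N : ℕ) (β h : ℝ) (k : ℕ) : ℝ :=
  N.choose k * Real.exp (N * (β * ((2 * k - N) / N) ^ p + h * ((2 * k - N) / N)))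

lemma mag_eq {N : ℕ} (σ : Fin N → Bool) :
    mag σ = 2 * ((Finset.univ.filter fun i => σ i = true).card : ℝ) - N := by
  have : ∀ i, spin (σ i) = 2 * (if σ i = true then 1 else 0) - 1 := by
    intro i; unfold spin; split_ifs <;> norm_num
  simp_rw [mag, this]
  rw [Finset.sum_sub_distrib, ← Finset.mul_sum, Finset.sum_boole]
  simp

lemma sum_config_eq {N : ℕ} (f : ℕ → ℝ) :
    ∑ σ : Fin N → Bool, f (Finset.univ.filter fun i => σ i = true).card =
      ∑ k ∈ Finset.range (N + 1), (N.choose k : ℝ) * f k := by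
  have h := Finset.sum_powerset_apply_card f (x := (Finset.univ : Finset (Fin N)))
  simp only [Finset.card_univ, Fintype.card_fin, nsmul_eq_mul] at h
  rw [← h]
  refine Finset.sum_bij' (fun σ _ => Finset.univ.filter fun i => σ i = true)
    (fun s _ i => decide (i ∈ s)) ?_ ?_ ?_ ?_ ?_
  · simp
  · simp
  · intro σ _; ext i; simp
  · intro s _; ext i; simp
  · simp

lemma cwHamiltonian_eq {p N : ℕ} (hN : 0 < N) (β h : ℝ) (σ : Fin N → Bool) :
    cwHamiltonian p N β h σ = N * (β * (mag σ / N) ^ p + h * (mag σ / N)) := by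
  have hN' : (N : ℝ) ≠ 0 := by exact_mod_cast hN.ne'
  have hsum : ∑ i : Fin p → Fin N, ∏ j, spin (σ (i j)) = mag σ ^ p := by
    rw [mag, Fintype.sum_pow]
  rw [cwHamiltonian, hsum, zpow_sub₀ hN', zpow_one, zpow_natCast, div_pow]
  field_simp

lemma cwProb_eq {p N : ℕ} (hN : 0 < N) (β h : ℝ) (P : ℝ → Prop) [DecidablePred P] :
    cwProb p N β h {σ | P (mag σ)} =
      (∑ k ∈ Finset.range (N + 1), if P (2 * k - N) then levelWeight p N β h k else 0) /
        ∑ k ∈ Finset.range (N + 1), levelWeight p N β h k := by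
  classical
  let e : ℕ → ℝ := fun k => Real.exp (N * (β * ((2 * k - N) / N) ^ p + h * ((2 * k - N) / N)))
  have hw : ∀ σ : Fin N → Bool, cwWeight p N β h σ =
      e (Finset.univ.filter fun i => σ i = true).card := by
    intro σ; rw [cwWeight, cwHamiltonian_eq hN, mag_eq]
  rw [cwProb]
  congr 1
  · have : ∀ σ : Fin N → Bool, Set.indicator {σ | P (mag σ)} (cwWeight p N β h) σ =
        (fun k : ℕ => if P (2 * k - N) then e k else 0)
          (Finset.univ.filter fun i => σ i = true).card := by
      intro σ
      rw [Set.indicator_apply, hw]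
      simp only [Set.mem_ofPred_eq, mag_eq]
    rw [Finset.sum_congr rfl fun σ _ => this σ,
      sum_config_eq (fun k : ℕ => if P (2 * k - N) then e k else 0)]
    refine Finset.sum_congr rfl fun k _ => ?_
    rw [mul_ite, mul_zero]
    rfl
  · rw [Finset.sum_congr rfl fun σ _ => hw σ, sum_config_eq e]
    rfl

lemma quartic_integral_zero {a : ℝ} (ha : 0 < a) :
    ∫ t in Set.Ioi (0 : ℝ), Real.exp (-a * t ^ 4) =
      a ^ (-(1 : ℝ) / 4) * (1 / 4) * Real.Gamma (1 / 4) := by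
  have h := integral_exp_neg_mul_rpow (p := 4) (b := a) (by norm_num) ha
  rw [Real.Gamma_add_one (by norm_num)] at h
  rw [mul_assoc, ← h]
  congr 1
  ext t
  norm_cast

/-- The logarithm of the scale of the weights `levelWeight p N β h k` with `(2 * k - N) / N` near
`m`. -/
def logLevelScale (p N : ℕ) (β h m : ℝ) : ℝ :=
  N * Real.log 2 + N * Hfun p β h m + Real.log (Stirling.stirlingSeq N) - 2 * Real.log √π +
    1 / 2 * Real.log (2 / N) - 1 / 2 * Real.log (1 - m ^ 2)

lemma levelWeight_pos {p N : ℕ} {β h : ℝ} {k : ℕ} (hk : k ≤ N) : 0 < levelWeight p N β h k := by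
  have : (0 : ℝ) < N.choose k := by exact_mod_cast Nat.choose_pos hk
  unfold levelWeight
  positivity

lemma log_levelWeight_sub {p N k : ℕ} {β h m : ℝ} (hk0 : 0 < k) (hk : k < N) :
    Real.log (levelWeight p N β h k) - logLevelScale p N β h m =
      N * (Hfun p β h ((2 * k - N) / N) - Hfun p β h m)
      - (Real.log (Stirling.stirlingSeq k) - Real.log √π)
      - (Real.log (Stirling.stirlingSeq (N - k)) - Real.log √π)
      - 1 / 2 * (Real.log (1 - ((2 * k - N) / N) ^ 2) - Real.log (1 - m ^ 2)) := by
  have hc : (N.choose k : ℝ) ≠ 0 := by exact_mod_cast (Nat.choose_pos hk.le).ne'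
  rw [levelWeight, Real.log_mul hc (Real.exp_pos _).ne', Real.log_exp, log_choose_eq hk0 hk,
    logLevelScale, Hfun, Hfun]
  ring

lemma levelWeight_near {q : ℕ} {β h m : ℝ} (hmax : isMaximizer (q + 3) β h m)
    (h2 : HfunD2 q β m = 0) :
    ∃ K : ℝ, 0 < K ∧ ∃ δ : ℝ, 0 < δ ∧ ∀ (u : ℝ) (N k : ℕ), 1 ≤ u → (N : ℝ) = u ^ 20 → k ≤ N →
      ∀ t : ℝ, t = (2 * k - N - N * m) / u ^ 15 → |t| ≤ δ * u ^ 5 →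
      ∃ E : ℝ, |E| ≤ K * (1 + |t| ^ 5) / u ^ 5 ∧
        levelWeight (q + 3) N β h k / Real.exp (logLevelScale (q + 3) N β h m) =
          Real.exp (-(-HfunD4 q β m / 24) * t ^ 4 + E) := by
  obtain ⟨hm1, hm2⟩ := hmax.1
  obtain ⟨K₀, hK₀, δ₁, hδ₁, hexp⟩ := Hfun_quartic_expansion hmax h2
  have hdiff : DifferentiableAt ℝ (fun y : ℝ => 1 / 2 * Real.log (1 - y ^ 2)) m := by
    have : 1 - m ^ 2 ≠ 0 := by nlinarith
    have hd : DifferentiableAt ℝ (fun y : ℝ => 1 - y ^ 2) m := by fun_prop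
    exact (hd.log this).const_mul _
  obtain ⟨L, hL, δ₂, hδ₂, hlip⟩ := hdiff.exists_abs_sub_le
  set r : ℝ := min (1 + m) (1 - m) / 2 with hr
  have hr0 : 0 < r := by
    have : 0 < min (1 + m) (1 - m) := lt_min (by linarith) (by linarith)
    positivity
  have hr1 : 2 * r ≤ 1 + m := by rw [hr]; linarith [min_le_left (1 + m) (1 - m)]
  have hr2 : 2 * r ≤ 1 - m := by rw [hr]; linarith [min_le_right (1 + m) (1 - m)]
  refine ⟨K₀ + 1 / (3 * r) + L, by positivity, min r (min δ₁ δ₂),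
    lt_min hr0 (lt_min hδ₁ hδ₂), ?_⟩
  intro u N k hu hN hk t ht htδ
  have hu0 : 0 < u := by linarith
  have hNpos : (0 : ℝ) < N := by rw [hN]; positivity
  set y : ℝ := (2 * k - N) / N with hy
  have hty : t = u ^ 5 * (y - m) := by
    rw [ht, hy, hN]; field_simp
  have hyabs : |t| = u ^ 5 * |y - m| := by
    rw [hty, abs_mul, abs_of_pos (by positivity : 0 < u ^ 5)]
  have hyδ : |y - m| ≤ min r (min δ₁ δ₂) := by
    rw [hyabs, mul_comm] at htδ
    exact le_of_mul_le_mul_right htδ (by positivity)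
  have hyr : |y - m| ≤ r := hyδ.trans (min_le_left _ _)
  have hy1 : |y - m| ≤ δ₁ := hyδ.trans ((min_le_right _ _).trans (min_le_left _ _))
  have hy2 : |y - m| ≤ δ₂ := hyδ.trans ((min_le_right _ _).trans (min_le_right _ _))
  obtain ⟨hya, hyb⟩ := abs_le.1 hyr
  have hkN : (k : ℝ) = N * (1 + y) / 2 := by rw [hy]; field_simp; ring
  have hkNr : N * r / 2 ≤ (k : ℝ) := by
    rw [hkN]; have := mul_le_mul_of_nonneg_left (show r ≤ 1 + y by linarith) hNpos.le; linarith
  have hNk : ((N - k : ℕ) : ℝ) = N * (1 - y) / 2 := by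
    rw [Nat.cast_sub hk, hkN]; ring
  have hNkr : N * r / 2 ≤ ((N - k : ℕ) : ℝ) := by
    rw [hNk]; have := mul_le_mul_of_nonneg_left (show r ≤ 1 - y by linarith) hNpos.le; linarith
  have hNr : 0 < N * r / 2 := by positivity
  have hk0 : 0 < k := by exact_mod_cast hNr.trans_le hkNr
  have hNk0 : 0 < N - k := by exact_mod_cast hNr.trans_le hNkr
  have hkN' : k < N := by omega
  have hlog := log_levelWeight_sub (p := q + 3) (β := β) (h := h) (m := m) hk0 hkN'
  rw [← hy] at hlog
  have hs1 := log_stirlingSeq_bounds hk0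
  have hs2 := log_stirlingSeq_bounds hNk0
  have hinv : ∀ j : ℝ, N * r / 2 ≤ j → 1 / (12 * j) ≤ 1 / (6 * r) / u ^ 5 := by
    intro j hj
    rw [div_div]
    refine one_div_le_one_div_of_le (by positivity) ?_
    have h5 : u ^ 5 ≤ N := by rw [hN]; exact pow_le_pow_right₀ hu (by norm_num)
    have := mul_le_mul_of_nonneg_right h5 hr0.le
    nlinarith
  have hb1 := hs1.2.trans (hinv _ hkNr)
  have hb2 := hs2.2.trans (hinv _ hNkr)
  have hH := hexp y hy1
  have hl := hlip y hy2
  set E : ℝ := Real.log (levelWeight (q + 3) N β h k) - logLevelScale (q + 3) N β h m +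
    (-HfunD4 q β m / 24) * t ^ 4 with hE
  refine ⟨E, ?_, ?_⟩
  · have hEeq : E = N * (Hfun (q + 3) β h y - Hfun (q + 3) β h m - HfunD4 q β m / 24 * (y - m) ^ 4)
        - (Real.log (Stirling.stirlingSeq k) - Real.log √π)
        - (Real.log (Stirling.stirlingSeq (N - k)) - Real.log √π)
        - (1 / 2 * Real.log (1 - y ^ 2) - 1 / 2 * Real.log (1 - m ^ 2)) := by
      rw [hE, hlog, hty, hN]; ring
    have hA : |N * (Hfun (q + 3) β h y - Hfun (q + 3) β h m - HfunD4 q β m / 24 * (y - m) ^ 4)| ≤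
        K₀ * |t| ^ 5 / u ^ 5 := by
      rw [abs_mul, abs_of_pos hNpos]
      refine (mul_le_mul_of_nonneg_left hH hNpos.le).trans (le_of_eq ?_)
      rw [hyabs, hN]; field_simp
    have hB : |1 / 2 * Real.log (1 - y ^ 2) - 1 / 2 * Real.log (1 - m ^ 2)| ≤
        L * |t| / u ^ 5 := by
      refine hl.trans (le_of_eq ?_)
      rw [hyabs, pow_one]; field_simp
    have ht5 : |t| ≤ 1 + |t| ^ 5 := by
      rcases le_total |t| 1 with h1 | h1
      · linarith [pow_nonneg (abs_nonneg t) 5]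
      · linarith [le_self_pow₀ h1 (show (5 : ℕ) ≠ 0 by norm_num)]
    have hC : K₀ * |t| ^ 5 / u ^ 5 ≤ K₀ * (1 + |t| ^ 5) / u ^ 5 := by gcongr; linarith
    have hD : L * |t| / u ^ 5 ≤ L * (1 + |t| ^ 5) / u ^ 5 := by gcongr
    have hF : 1 / (3 * r) / u ^ 5 ≤ 1 / (3 * r) * (1 + |t| ^ 5) / u ^ 5 := by
      gcongr
      exact le_mul_of_one_le_right (by positivity) (by linarith [pow_nonneg (abs_nonneg t) 5])
    have hG : 1 / (6 * r) / u ^ 5 + 1 / (6 * r) / u ^ 5 = 1 / (3 * r) / u ^ 5 := by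
      field_simp; norm_num
    have hsum : (K₀ + 1 / (3 * r) + L) * (1 + |t| ^ 5) / u ^ 5 =
        K₀ * (1 + |t| ^ 5) / u ^ 5 + 1 / (3 * r) * (1 + |t| ^ 5) / u ^ 5 +
          L * (1 + |t| ^ 5) / u ^ 5 := by ring
    rw [hsum, hEeq]
    obtain ⟨a1, a2⟩ := abs_le.1 hA
    obtain ⟨b1, b2⟩ := abs_le.1 hB
    rw [abs_le]
    constructor <;> linarith [hs1.1, hs2.1]
  · rw [show -(-HfunD4 q β m / 24) * t ^ 4 + E =
      Real.log (levelWeight (q + 3) N β h k) - logLevelScale (q + 3) N β h m by rw [hE]; ring,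
      Real.exp_sub, Real.exp_log (levelWeight_pos hk)]

lemma levelWeight_le {p N k : ℕ} {β h : ℝ} (hN : 0 < N) (hk : k ≤ N) :
    levelWeight p N β h k ≤ Real.exp (N * Real.log 2 + N * Hfun p β h ((2 * k - N) / N)) := by
  refine (mul_le_mul_of_nonneg_right (choose_le_exp_entropy hN hk) (Real.exp_pos _).le).trans
    (le_of_eq ?_)
  rw [← Real.exp_add, Hfun]
  congr 1
  ring

lemma levelWeight_far {q : ℕ} {β h m δ : ℝ} (hβ : 0 < β) (hh : 0 < h)
    (hm : isUniqueMaximizer (q + 3) β h m) (hδ : 0 < δ) :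
    ∃ c : ℝ, 0 < c ∧ ∃ B : ℝ, 0 < B ∧ ∀ (u : ℝ) (N k : ℕ), 1 ≤ u → (N : ℝ) = u ^ 20 → k ≤ N →
      ∀ t : ℝ, t = (2 * k - N - N * m) / u ^ 15 → δ * u ^ 5 < |t| →
      levelWeight (q + 3) N β h k / Real.exp (logLevelScale (q + 3) N β h m) ≤
          B * u ^ 10 * Real.exp (-c * u ^ 20) := by
  obtain ⟨hm1, hm2⟩ := hm.1.1
  obtain ⟨c, hc, hgap⟩ := Hfun_gap hβ hh hm hδ
  refine ⟨c, hc, √π, Real.sqrt_pos.2 Real.pi_pos, ?_⟩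
  intro u N k hu hN hk t ht htδ
  have hu0 : 0 < u := by linarith
  have hNpos : (0 : ℝ) < N := by rw [hN]; positivity
  have hN0 : 0 < N := by exact_mod_cast hNpos
  set y : ℝ := (2 * k - N) / N with hy
  have hty : t = u ^ 5 * (y - m) := by
    rw [ht, hy, hN]; field_simp
  have hyδ : δ < |y - m| := by
    rw [hty, abs_mul, abs_of_pos (by positivity : 0 < u ^ 5), mul_comm] at htδ
    exact lt_of_mul_lt_mul_left htδ (by positivity)
  have hkN : (k : ℝ) ≤ N := by exact_mod_cast hk
  have hk0 : (0 : ℝ) ≤ k := k.cast_nonneg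
  have hyI : y ∈ Set.Icc (-1 : ℝ) 1 := by
    constructor
    · rw [hy, le_div_iff₀ hNpos]; linarith
    · rw [hy, div_le_iff₀ hNpos]; linarith
  have hH := hgap y hyI hyδ
  have hpi : 0 < √π := Real.sqrt_pos.2 Real.pi_pos
  have hrhs : √π * u ^ 10 * Real.exp (-c * u ^ 20) =
      Real.exp (Real.log √π + 1 / 2 * Real.log N - c * N) := by
    rw [sub_eq_add_neg, Real.exp_add, Real.exp_add, Real.exp_log hpi, hN, Real.log_pow]
    rw [show 1 / 2 * (((20 : ℕ) : ℝ) * Real.log u) = ((10 : ℕ) : ℝ) * Real.log u by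
      push_cast; ring, Real.exp_nat_mul, Real.exp_log hu0, neg_mul]
  rw [hrhs, div_le_iff₀ (Real.exp_pos _), ← Real.exp_add]
  refine (levelWeight_le hN0 hk).trans (Real.exp_le_exp.2 ?_)
  have hs := (log_stirlingSeq_bounds hN0).1
  have hm0 : Real.log (1 - m ^ 2) ≤ 0 :=
    Real.log_nonpos (by nlinarith) (by nlinarith)
  have hl : Real.log (2 / N) = Real.log 2 - Real.log N := Real.log_div two_ne_zero hNpos.ne'
  have hl2 : 0 < Real.log 2 := Real.log_pos (by norm_num)
  have := mul_le_mul_of_nonneg_left hH hNpos.le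
  rw [logLevelScale, hl]
  linarith

lemma levelWeight_tail_estimate {q : ℕ} {β h m : ℝ} (hβ : 0 < β) (hh : 0 < h)
    (hm : isUniqueMaximizer (q + 3) β h m) (h2 : HfunD2 q β m = 0) :
    ∃ C : ℝ, 0 < C ∧ ∃ u₀ : ℝ, 1 ≤ u₀ ∧ ∀ (u : ℝ) (N : ℕ), u₀ ≤ u → (N : ℝ) = u ^ 20 →
      ∃ A : ℝ, 0 < A ∧ ∀ x, 0 ≤ x → x ≤ u → ∀ s : ℝ, s = 1 ∨ s = -1 →
      |A * (∑ k ∈ Finset.range (N + 1), if x < s * (2 * k - N - N * m) / u ^ 15 then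
          levelWeight (q + 3) N β h k else 0) - quarticTail (-HfunD4 q β m / 24) x| ≤
        C * ((1 + x ^ 5) / u ^ 5) * quarticTail (-HfunD4 q β m / 24) x ∧
      |A * (∑ k ∈ Finset.range (N + 1), if x ≤ s * (2 * k - N - N * m) / u ^ 15 then
          levelWeight (q + 3) N β h k else 0) - quarticTail (-HfunD4 q β m / 24) x| ≤
        C * ((1 + x ^ 5) / u ^ 5) * quarticTail (-HfunD4 q β m / 24) x := by
  obtain ⟨hm1, hm2⟩ := hm.1.1
  have h4 : HfunD4 q β m < 0 := HfunD4_neg hm.1.1 h2 (HfunD3_eq_zero hm.1 h2)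
  set a : ℝ := -HfunD4 q β m / 24 with ha_def
  have ha : 0 < a := by rw [ha_def]; linarith
  obtain ⟨K, hK, δ₁, hδ₁, hnear⟩ := levelWeight_near hm.1 h2
  set δ : ℝ := min (min δ₁ (a / (4 * K))) (min (1 + m) (1 - m)) with hδ_def
  have hδ : 0 < δ := lt_min (lt_min hδ₁ (by positivity)) (lt_min (by linarith) (by linarith))
  have hδδ₁ : δ ≤ δ₁ := (min_le_left _ _).trans (min_le_left _ _)
  have hδa : δ ≤ a / (4 * K) := (min_le_left _ _).trans (min_le_right _ _)
  have hδm : δ ≤ 1 + m := (min_le_right _ _).trans (min_le_left _ _)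
  have hδm' : δ ≤ 1 - m := (min_le_right _ _).trans (min_le_right _ _)
  have hKδ : 2 * K * δ ≤ a / 2 := by
    rw [le_div_iff₀ (by positivity)] at hδa; linarith
  obtain ⟨c, hc, B, hB, hfar⟩ := levelWeight_far hβ hh hm hδ
  obtain ⟨C, hC, u₀, hu₀, hest⟩ := full_grid_tail_estimate ha hK hδ hKδ hc hB
  refine ⟨C, hC, u₀, hu₀, fun u N hu hN => ?_⟩
  have hu1 : 1 ≤ u := hu₀.trans hu
  have hu0 : 0 < u := by linarith
  have hNpos : (0 : ℝ) < N := by rw [hN]; positivity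
  have hN1 : (1 : ℝ) ≤ N := by rw [hN]; exact one_le_pow₀ hu1
  set S : ℝ := Real.exp (logLevelScale (q + 3) N β h m) with hS
  have hS0 : 0 < S := Real.exp_pos _
  refine ⟨2 / u ^ 15 / S, by positivity, fun x hx hxu => ?_⟩
  have hn : ((N + 1 : ℕ) : ℝ) ≤ 2 * u ^ 20 := by push_cast; rw [← hN]; linarith
  have hNu : (N : ℝ) / u ^ 15 = u ^ 5 := by rw [hN]; field_simp
  have hpos := hest u hu (N + 1) (-(1 + m) * u ^ 5)
    (fun k => levelWeight (q + 3) N β h k / S)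
  have hneg := hest u hu (N + 1) (-(1 - m) * u ^ 5)
    (fun k => levelWeight (q + 3) N β h (N - k) / S)
  have hgrid : ∀ k : ℕ, -(1 + m) * u ^ 5 + 2 / u ^ 15 * k = (2 * k - N - N * m) / u ^ 15 := by
    intro k; rw [← hNu]; ring
  have hgrid' : ∀ k : ℕ, k ≤ N →
      -(1 - m) * u ^ 5 + 2 / u ^ 15 * k = -((2 * (N - k : ℕ) - N - N * m) / u ^ 15) := by
    intro k hk; rw [← hNu, Nat.cast_sub hk]; ring
  have hu5 : 0 < u ^ 5 := by positivity
  have hu15 : 0 < 2 / u ^ 15 := by positivity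
  have hend : δ * u ^ 5 ≤ (1 - m) * u ^ 5 := mul_le_mul_of_nonneg_right hδm' hu5.le
  have hend' : δ * u ^ 5 ≤ (1 + m) * u ^ 5 := mul_le_mul_of_nonneg_right hδm hu5.le
  have hNu2 : 2 / u ^ 15 * (N : ℝ) = 2 * u ^ 5 := by rw [← hNu]; ring
  have hδu : ∀ t : ℝ, |t| ≤ δ * u ^ 5 → |t| ≤ δ₁ * u ^ 5 := fun t ht =>
    ht.trans (mul_le_mul_of_nonneg_right hδδ₁ hu5.le)
  replace hpos := hpos (by nlinarith) hn (by push_cast; linarith)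
    (by
      intro k hk hkt
      rw [hgrid] at hkt ⊢
      exact hnear u N k hu1 hN (by omega) _ rfl (hδu _ hkt))
    (by
      intro k hk hkt
      rw [hgrid] at hkt
      exact ⟨div_nonneg (levelWeight_pos (by omega)).le hS0.le,
        hfar u N k hu1 hN (by omega) _ rfl hkt⟩) x hx hxu
  replace hneg := hneg (by nlinarith) hn (by push_cast; linarith)
    (by
      intro k hk hkt
      rw [hgrid' k (by omega)] at hkt ⊢
      rw [abs_neg] at hkt ⊢
      rw [Even.neg_pow (by decide)]
      exact hnear u N (N - k) hu1 hN (by omega) _ rfl (hδu _ hkt))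
    (by
      intro k hk hkt
      rw [hgrid' k (by omega), abs_neg] at hkt
      exact ⟨div_nonneg (levelWeight_pos (by omega)).le hS0.le,
        hfar u N (N - k) hu1 hN (by omega) _ rfl hkt⟩) x hx hxu
  have hscale : ∀ f : ℕ → ℝ, 2 / u ^ 15 / S * ∑ k ∈ Finset.range (N + 1), f k =
      2 / u ^ 15 * ∑ k ∈ Finset.range (N + 1), f k / S := by
    intro f; rw [← Finset.sum_div]; ring
  have hreflect : ∀ f : ℕ → ℝ, ∑ k ∈ Finset.range (N + 1), f k =
      ∑ k ∈ Finset.range (N + 1), f (N - k) := by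
    intro f; rw [← Finset.sum_range_reflect]; simp
  rintro s (rfl | rfl)
  · rw [hscale, hscale]
    simpa only [ite_div, zero_div, one_mul, hgrid] using hpos
  · rw [hscale, hscale, hreflect, hreflect (fun k => (if x ≤ _ then _ else _) / S)]
    have e1 : ∀ k ∈ Finset.range (N + 1), -(1 - m) * u ^ 5 + 2 / u ^ 15 * k =
        -1 * (2 * (N - k : ℕ) - N - N * m) / u ^ 15 := by
      intro k hk
      rw [hgrid' k (Nat.lt_succ_iff.1 (Finset.mem_range.1 hk))]; ring
    constructor
    · refine le_trans (le_of_eq ?_) hneg.1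
      congr 3
      refine Finset.sum_congr rfl fun k hk => ?_
      rw [e1 k hk, ite_div, zero_div]
    · refine le_trans (le_of_eq ?_) hneg.2
      congr 3
      refine Finset.sum_congr rfl fun k hk => ?_
      rw [e1 k hk, ite_div, zero_div]

lemma one_sub_specialCDF {c a x : ℝ} (ha : 0 < a) (hc : a = -c / 24) :
    1 - specialCDF c x = quarticTail a x / (2 * quarticTail a 0) := by
  have hint := integrable_exp_neg_mul_pow_four ha
  have hG : 0 < Real.Gamma (1 / 4) := Real.Gamma_pos_of_pos (by norm_num)
  have h0 : quarticTail a 0 = a ^ (-(1 : ℝ) / 4) * (1 / 4) * Real.Gamma (1 / 4) :=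
    quartic_integral_zero ha
  have hT0 : 0 < quarticTail a 0 := quarticTail_pos ha le_rfl
  have hnorm : 2 / Real.Gamma (1 / 4) * (-c / 24) ^ ((1 : ℝ) / 4) = 1 / (2 * quarticTail a 0) := by
    rw [h0, ← hc, neg_div, Real.rpow_neg ha.le]
    have : 0 < a ^ ((1 : ℝ) / 4) := by positivity
    field_simp
    norm_num
  have hsplit := integral_add_compl (measurableSet_Iic (a := x)) hint
  rw [Set.compl_Iic] at hsplit
  have htotal : ∫ t, Real.exp (-a * t ^ 4) = 2 * quarticTail a 0 := by
    have := integral_comp_abs (f := fun t => Real.exp (-a * t ^ 4))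
    rw [quarticTail, ← this]
    congr 1
    ext t
    rw [Even.pow_abs (by decide)]
  rw [htotal] at hsplit
  have hcdf : specialCDF c x = 1 / (2 * quarticTail a 0) *
      ∫ t in Set.Iic x, Real.exp (-a * t ^ 4) := by
    rw [specialCDF, hnorm, integral_const_mul]
    congr 2
    ext t
    rw [hc]; congr 1; ring
  rw [hcdf]
  have : ∫ t in Set.Iic x, Real.exp (-a * t ^ 4) = 2 * quarticTail a 0 - quarticTail a x := by
    have : quarticTail a x = ∫ t in Set.Ioi x, Real.exp (-a * t ^ 4) := rfl
    linarith
  rw [this]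
  field_simp
  ring

lemma abs_ratio_sub_one_le {s S T U e e₀ : ℝ} (hT : 0 < T) (hU : 0 < U) (he₀ : e₀ ≤ 1 / 2)
    (he0 : 0 ≤ e₀) (hs : |s - T| ≤ e * T) (hS : |S - U| ≤ e₀ * U) :
    |s / S / (T / U) - 1| ≤ 2 * (e + e₀) := by
  obtain ⟨hS1, hS2⟩ := abs_le.1 hS
  have hSU : U / 2 ≤ S := by nlinarith
  have hS0 : 0 < S := by linarith
  have : s / S / (T / U) - 1 = ((s - T) * U - T * (S - U)) / (S * T) := by field_simp; ring
  rw [this, abs_div, abs_of_pos (mul_pos hS0 hT), div_le_iff₀ (mul_pos hS0 hT)]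
  calc |(s - T) * U - T * (S - U)| ≤ |(s - T) * U| + |T * (S - U)| := abs_sub _ _
    _ = |s - T| * U + T * |S - U| := by rw [abs_mul, abs_mul, abs_of_pos hU, abs_of_pos hT]
    _ ≤ e * T * U + T * (e₀ * U) := by gcongr
    _ = (e + e₀) * T * U := by ring
    _ ≤ 2 * (e + e₀) * (S * T) := by
      have hee : 0 ≤ e + e₀ := by
        have : 0 ≤ e := by
          by_contra hneg
          have := (abs_nonneg _).trans hs
          nlinarith
        linarith
      have := mul_le_mul_of_nonneg_left hSU (mul_nonneg hee hT.le)
      nlinarith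

lemma cwProb_nonneg {p N : ℕ} {β h : ℝ} (E : Set (Fin N → Bool)) : 0 ≤ cwProb p N β h E := by
  refine div_nonneg (Finset.sum_nonneg fun x _ => Set.indicator_nonneg (fun y _ => ?_) x)
    (Finset.sum_nonneg fun x _ => ?_) <;> exact (Real.exp_pos _).le

lemma cwProb_le_one {p N : ℕ} {β h : ℝ} (E : Set (Fin N → Bool)) : cwProb p N β h E ≤ 1 := by
  refine div_le_one_of_le₀ (Finset.sum_le_sum fun x _ =>
    Set.indicator_le_self' (fun y _ => ?_) x) (Finset.sum_nonneg fun x _ => ?_) <;>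
  exact (Real.exp_pos _).le

/-- **Moderate deviations at `p`-special points.** -/
theorem moderate_deviation_special
    (p : ℕ) (hp : 3 ≤ p) (β h m : ℝ) (hβ : 0 < β) (hh : 0 < h)
    (hsp : pSpecial p β h m) :
    ∃ C : ℝ, 0 < C ∧ ∃ C' : ℝ, 0 < C' ∧
      ∀ N : ℕ, 1 ≤ N → ∀ r ∈ ({0, 1} : Set ℕ), ∀ x : ℝ,
        0 ≤ x → x ≤ C * (N : ℝ) ^ ((1:ℝ)/20) →
        |cwProb p N β h
            {σ | (-1 : ℝ) ^ r * (mag σ - N * m) / (N : ℝ) ^ ((3:ℝ)/4) > x} /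
            (1 - specialCDF (iteratedDeriv 4 (Hfun p β h) m) x) - 1|
          ≤ C' * (1 + x ^ 5) * (N : ℝ) ^ (-(1:ℝ)/4) := by
  obtain ⟨q, rfl⟩ : ∃ q, p = q + 3 := ⟨p - 3, by omega⟩
  obtain ⟨hm, hd2⟩ := hsp
  have h2 : HfunD2 q β m = 0 := by rw [← (iteratedDeriv_Hfun (h := h) hm.1.1).1]; exact hd2
  have h4 : HfunD4 q β m < 0 := HfunD4_neg hm.1.1 h2 (HfunD3_eq_zero hm.1 h2)
  rw [(iteratedDeriv_Hfun hm.1.1).2]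
  obtain ⟨C, hC, u₀, hu₀, hest⟩ := levelWeight_tail_estimate hβ hh hm h2
  set a : ℝ := -HfunD4 q β m / 24 with ha_def
  have ha : 0 < a := by rw [ha_def]; linarith
  simp only [fun x => one_sub_specialCDF (x := x) ha ha_def]
  have hT0 := quarticTail_pos ha (le_refl (0 : ℝ))
  set u₁ : ℝ := max u₀ (2 * C) with hu₁
  have hu₁0 : u₀ ≤ u₁ := le_max_left _ _
  have hu₁pos : 0 < u₁ := by linarith
  have hT1 := quarticTail_pos ha hu₁pos.le
  set D : ℝ := 2 * quarticTail a 0 / quarticTail a u₁ + 1 with hD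
  have hD0 : 0 < D := by positivity
  refine ⟨1, one_pos, 4 * C + D * u₁ ^ 5, by positivity, ?_⟩
  intro N hN r hr x hx hxu
  have hN1 : (1 : ℝ) ≤ N := by exact_mod_cast hN
  have hN0 : (0 : ℝ) < N := by linarith
  set u : ℝ := (N : ℝ) ^ ((1 : ℝ) / 20) with hu
  have hu1 : 1 ≤ u := Real.one_le_rpow hN1 (by norm_num)
  have hu0 : 0 < u := by linarith
  have hu20 : (N : ℝ) = u ^ 20 := by
    rw [hu, ← Real.rpow_natCast, ← Real.rpow_mul hN0.le]; norm_num
  have hu15 : (N : ℝ) ^ ((3 : ℝ) / 4) = u ^ 15 := by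
    rw [hu, ← Real.rpow_natCast, ← Real.rpow_mul hN0.le]; norm_num
  have hu5 : (N : ℝ) ^ (-(1 : ℝ) / 4) = 1 / u ^ 5 := by
    rw [hu, ← Real.rpow_natCast, ← Real.rpow_mul hN0.le, one_div, ← Real.rpow_neg hN0.le]
    norm_num
  rw [one_mul] at hxu
  rw [hu15, hu5]
  have hTx := quarticTail_pos ha hx
  have hx5 : 1 ≤ 1 + x ^ 5 := by linarith [pow_nonneg hx 5]
  rcases le_total u₁ u with hlarge | hsmall
  · obtain ⟨A, hA, hAest⟩ := hest u N (hu₁0.trans hlarge) hu20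
    have hs : (-1 : ℝ) ^ r = 1 ∨ (-1 : ℝ) ^ r = -1 := by
      rcases hr with rfl | rfl <;> simp
    have hprob := cwProb_eq (p := q + 3) (Nat.pos_of_ne_zero (by omega : N ≠ 0)) β h
      (fun M => (-1 : ℝ) ^ r * (M - N * m) / u ^ 15 > x)
    have hnum := (hAest x hx hxu _ hs).1
    have hpos := (hAest 0 le_rfl hu0.le 1 (Or.inl rfl)).1
    have hneg := (hAest 0 le_rfl hu0.le (-1) (Or.inr rfl)).2
    set Z : ℝ := ∑ k ∈ Finset.range (N + 1), levelWeight (q + 3) N β h k with hZ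
    have hsplit : Z = (∑ k ∈ Finset.range (N + 1),
          if 0 < 1 * (2 * (k : ℝ) - N - N * m) / u ^ 15 then levelWeight (q + 3) N β h k else 0) +
        ∑ k ∈ Finset.range (N + 1),
          if 0 ≤ -1 * (2 * (k : ℝ) - N - N * m) / u ^ 15 then
            levelWeight (q + 3) N β h k else 0 := by
      rw [hZ, ← Finset.sum_add_distrib]
      refine Finset.sum_congr rfl fun k _ => ?_
      rw [one_mul, neg_one_mul, neg_div]
      rcases lt_or_ge 0 ((2 * (k : ℝ) - N - N * m) / u ^ 15) with hlt | hge
      · rw [if_pos hlt, if_neg (by linarith), add_zero]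
      · rw [if_neg (by linarith), if_pos (by linarith), zero_add]
    have htot : |A * Z - 2 * quarticTail a 0| ≤ C / u ^ 5 * (2 * quarticTail a 0) := by
      rw [hsplit, mul_add]
      norm_num at hpos hneg
      have e : C / u ^ 5 = C * (u ^ 5)⁻¹ := div_eq_mul_inv _ _
      rw [e]
      norm_num
      rw [abs_le] at *
      constructor <;> linarith [hpos.1, hpos.2, hneg.1, hneg.2]
    rw [hprob, ← mul_div_mul_left _ Z hA.ne']
    have hCu : C / u ^ 5 ≤ 1 / 2 := by
      rw [div_le_iff₀ (by positivity)]
      have := le_self_pow₀ hu1 (show (5 : ℕ) ≠ 0 by norm_num)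
      linarith [(le_max_right u₀ (2 * C)).trans hlarge]
    refine (abs_ratio_sub_one_le hTx (by positivity) hCu (by positivity) hnum htot).trans ?_
    have : C / u ^ 5 ≤ C * ((1 + x ^ 5) / u ^ 5) := by
      rw [mul_div_assoc']; gcongr; exact le_mul_of_one_le_right hC.le hx5
    calc 2 * (C * ((1 + x ^ 5) / u ^ 5) + C / u ^ 5) ≤ 4 * (C * ((1 + x ^ 5) / u ^ 5)) := by
          linarith
      _ = 4 * C * (1 + x ^ 5) * (1 / u ^ 5) := by ring
      _ ≤ (4 * C + D * u₁ ^ 5) * (1 + x ^ 5) * (1 / u ^ 5) := by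
          gcongr
          linarith [mul_pos hD0 (pow_pos hu₁pos 5)]
  · have hratio : ∀ P : ℝ, 0 ≤ P → P ≤ 1 →
        |P / (quarticTail a x / (2 * quarticTail a 0)) - 1| ≤ D := by
      intro P hP0 hP1
      have hT : quarticTail a u₁ ≤ quarticTail a x := quarticTail_antitone ha (hxu.trans hsmall)
      have hb : P / (quarticTail a x / (2 * quarticTail a 0)) ≤
          2 * quarticTail a 0 / quarticTail a u₁ := by
        rw [div_div_eq_mul_div]
        exact div_le_div₀ (by positivity) (mul_le_of_le_one_left (by positivity) hP1) hT1 hT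
      have hb0 : 0 ≤ P / (quarticTail a x / (2 * quarticTail a 0)) := by positivity
      have : 0 ≤ 2 * quarticTail a 0 / quarticTail a u₁ := by positivity
      rw [abs_le]
      constructor <;> linarith
    refine (hratio _ (cwProb_nonneg _) (cwProb_le_one _)).trans ?_
    have h1 : 1 ≤ u₁ ^ 5 * (1 / u ^ 5) := by
      rw [mul_one_div, one_le_div (by positivity)]
      gcongr
    calc D ≤ D * (u₁ ^ 5 * (1 / u ^ 5)) := le_mul_of_one_le_right hD0.le h1
      _ = D * u₁ ^ 5 * (1 / u ^ 5) := by ring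
      _ ≤ (4 * C + D * u₁ ^ 5) * (1 + x ^ 5) * (1 / u ^ 5) := by
        refine mul_le_mul_of_nonneg_right ?_ (by positivity)
        nlinarith [mul_pos hD0 (pow_pos hu₁pos 5)]
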